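/- arXiv:2211.16886 — 5 statements merged into one kernel-verified Lean document; each statement's English description precedes it below -/
import Mathlib

section
/- Let 𝒳 be a measurable space, D a probability distribution over 𝒳×{0,1} with cal(D) nonempty, and f:𝒳→[0,1] a measurable predictor. Let g be (a version of) the conditional expectation of the label y given the σ-algebra generated by f, i.e. g(x) = E_D[y ∣ f(x)]. Then g ∈ cal(D), the expected calibration error ECE_D(f) := E_{(x,y)∼D}|g(x) − f(x)| equals E_D|f − g|, and consequently dCE_D(f) ≤ ECE_D(f). -/
open MeasureTheory Set

noncomputable section

/-- The unit interval `[0,1]` as a type. -/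
abbrev I01 : Type := unitInterval

/-- The real value of a Boolean label. -/
def lbl (y : Bool) : ℝ := if y then 1 else 0

/-- The calibration correlation `E_{(v,y)∼Γ}[(y − v)·w(v)]` against a weight function `w`. -/
def calErr (Γ : Measure (I01 × Bool)) (w : I01 → ℝ) : ℝ :=
  ∫ p, (lbl p.2 - (p.1 : ℝ)) * w p.1 ∂Γ

/-- A prediction-label distribution `Γ` on `[0,1] × {0,1}` is perfectly calibrated iff
`E[(y − v)·w(v)] = 0` for every bounded measurable weight function `w`. -/
def PerfCal (Γ : Measure (I01 × Bool)) : Prop :=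
  ∀ w : I01 → ℝ, Measurable w → (∃ C : ℝ, ∀ t, |w t| ≤ C) → calErr Γ w = 0

/-- `ext(Γ)`: couplings `Π` of triples `(u,v,y)` whose `(v,y)`-marginal is `Γ` and whose
`(u,y)`-marginal is perfectly calibrated. -/
def extSet (Γ : Measure (I01 × Bool)) : Set (Measure (I01 × I01 × Bool)) :=
  {π | IsProbabilityMeasure π ∧
    π.map (fun p => (p.2.1, p.2.2)) = Γ ∧
    PerfCal (π.map (fun p => (p.1, p.2.2)))}

/-- The lower distance to calibration `ldCE(Γ)`. -/
def ldCE (Γ : Measure (I01 × Bool)) : ℝ :=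
  sInf {x | ∃ π ∈ extSet Γ, x = ∫ p, |(p.1 : ℝ) - (p.2.1 : ℝ)| ∂π}

/-- The upper distance to calibration `udCE(Γ)`: distance to calibration via post-processing. -/
def udCE (Γ : Measure (I01 × Bool)) : ℝ :=
  sInf {x | ∃ κ : I01 → I01, Measurable κ ∧
    PerfCal (Γ.map (fun p => (κ p.1, p.2))) ∧
    x = ∫ p, |(p.1 : ℝ) - (κ p.1 : ℝ)| ∂Γ}

/-- The smooth calibration error `smCE(Γ)`: supremum of `E[(y−v)w(v)]` over `1`-Lipschitz
weight functions `w : [0,1] → [−1,1]`. -/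
def smCE (Γ : Measure (I01 × Bool)) : ℝ :=
  sSup {x | ∃ w : I01 → ℝ, LipschitzWith 1 w ∧ (∀ t, |w t| ≤ 1) ∧ x = calErr Γ w}

/-- The prediction-label distribution `D_f` induced by a predictor `f`. -/
def predDist {𝒳 : Type*} [MeasurableSpace 𝒳] (D : Measure (𝒳 × Bool)) (f : 𝒳 → I01) :
    Measure (I01 × Bool) :=
  D.map (fun p => (f p.1, p.2))

/-- `cal(D)`: the set of measurable predictors that are perfectly calibrated w.r.t. `D`. -/
def calSet {𝒳 : Type*} [MeasurableSpace 𝒳] (D : Measure (𝒳 × Bool)) : Set (𝒳 → I01) :=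
  {g | Measurable g ∧ PerfCal (predDist D g)}

/-- The true (ℓ₁) distance to calibration `dCE_D(f)`. -/
def dCE {𝒳 : Type*} [MeasurableSpace 𝒳] (D : Measure (𝒳 × Bool)) (f : 𝒳 → I01) : ℝ :=
  sInf {x | ∃ g ∈ calSet D, x = ∫ p, |(f p.1 : ℝ) - (g p.1 : ℝ)| ∂D}

/-- A finite partition of `[0,1]` into (order-convex) intervals. -/
structure IntervalPartition where
  m : ℕ
  piece : Fin m → Set ℝ
  ordConn : ∀ j, (piece j).OrdConnected
  disj : ∀ i j, i ≠ j → Disjoint (piece i) (piece j)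
  cover : (⋃ j, piece j) = Set.Icc (0 : ℝ) 1

/-- `binnedECE(Γ, 𝓘) = Σ_j |E[(v − y)·1(v ∈ I_j)]|`. -/
def binnedECE (Γ : Measure (I01 × Bool)) (P : IntervalPartition) : ℝ :=
  ∑ j : Fin P.m,
    |∫ p, Set.indicator (P.piece j) (fun _ => ((p.1 : ℝ) - lbl p.2)) (p.1 : ℝ) ∂Γ|

/-- The average interval width `w_Γ(𝓘) = Σ_j E[1(v ∈ I_j)]·w(I_j)`. -/
def avgWidth (Γ : Measure (I01 × Bool)) (P : IntervalPartition) : ℝ :=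
  ∑ j : Fin P.m,
    (∫ p, Set.indicator (P.piece j) (fun _ => (1 : ℝ)) (p.1 : ℝ) ∂Γ) * Metric.diam (P.piece j)

/-- The interval calibration error `intCE(Γ)`. -/
def intCE (Γ : Measure (I01 × Bool)) : ℝ :=
  sInf {x | ∃ P : IntervalPartition, x = binnedECE Γ P + avgWidth Γ P}

/-- The random interval calibration error `RintCE(Γ, ε)`, with `r` uniform on `[0, ε)` and
intervals `I^ε_{r,j} = [r + jε, r + (j+1)ε)`. -/
def RintCE (Γ : Measure (I01 × Bool)) (ε : ℝ) : ℝ :=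
  (1 / ε) * ∫ r in Set.Ico (0 : ℝ) ε,
    ∑' j : ℤ, |∫ p, Set.indicator (Set.Ico (r + (j : ℝ) * ε) (r + ((j : ℝ) + 1) * ε))
      (fun _ => (lbl p.2 - (p.1 : ℝ))) (p.1 : ℝ) ∂Γ|

/-- The surrogate interval calibration error `SintCE(Γ)`. -/
def SintCE (Γ : Measure (I01 × Bool)) : ℝ :=
  ⨅ k : ℕ, (RintCE Γ ((1 / 2) ^ k) + (1 / 2) ^ k)

/-- The squared Laplace-kernel calibration error:
`K_Lap(Γ) = E[(y−v)(y′−v′)·exp(−|v−v′|)]` over two independent samples from `Γ`. -/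
def KLap (Γ : Measure (I01 × Bool)) : ℝ :=
  ∫ q, (lbl q.1.2 - (q.1.1 : ℝ)) * (lbl q.2.2 - (q.2.1 : ℝ)) *
    Real.exp (-|(q.1.1 : ℝ) - (q.2.1 : ℝ)|) ∂(Γ.prod Γ)

/-- The squared Gaussian-kernel calibration error:
`K_Gauss(Γ) = E[(y−v)(y′−v′)·exp(−(v−v′)²)]` over two independent samples from `Γ`. -/
def KGauss (Γ : Measure (I01 × Bool)) : ℝ :=
  ∫ q, (lbl q.1.2 - (q.1.1 : ℝ)) * (lbl q.2.2 - (q.2.1 : ℝ)) *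
    Real.exp (-(((q.1.1 : ℝ) - (q.2.1 : ℝ)) ^ 2)) ∂(Γ.prod Γ)

/-- If `g` is (a version of) the conditional expectation `E_D[y ∣ f(x)]`,
then `g ∈ cal(D)`, `ECE_D(f) = E_D|f − g|`, and consequently `dCE_D(f) ≤ ECE_D(f)`. -/
theorem ECE_eq_ell1_to_condexp_and_dCE_le {𝒳 : Type*} [MeasurableSpace 𝒳]
    (D : Measure (𝒳 × Bool)) [IsProbabilityMeasure D]
    (hne : (calSet D).Nonempty)
    (f g : 𝒳 → I01) (hf : Measurable f) (hg : Measurable g)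
    (hcond : (fun p : 𝒳 × Bool => (g p.1 : ℝ)) =ᵐ[D]
      D[(fun p : 𝒳 × Bool => lbl p.2) |
        MeasurableSpace.comap (fun p : 𝒳 × Bool => f p.1) inferInstance]) :
    g ∈ calSet D ∧
    (∫ p, |(g p.1 : ℝ) - (f p.1 : ℝ)| ∂D) = (∫ p, |(f p.1 : ℝ) - (g p.1 : ℝ)| ∂D) ∧
    dCE D f ≤ ∫ p, |(g p.1 : ℝ) - (f p.1 : ℝ)| ∂D := by
  have hm : MeasurableSpace.comap (fun p : 𝒳 × Bool => f p.1) inferInstance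
      ≤ (inferInstance : MeasurableSpace (𝒳 × Bool)) :=
    (hf.comp measurable_fst).comap_le
  have hlbl : Measurable (fun p : 𝒳 × Bool => lbl p.2) :=
    (measurable_from_top (f := lbl)).comp measurable_snd
  have hlb : ∀ b, |lbl b| ≤ 1 := by intro b; cases b <;> simp [lbl]
  have hYint : Integrable (fun p : 𝒳 × Bool => lbl p.2) D :=
    Integrable.of_bound hlbl.aestronglyMeasurable 1
      (Filter.Eventually.of_forall fun p => by simpa using hlb p.2)
  have hcal : g ∈ calSet D := by
    refine ⟨hg, ?_⟩
    intro w hw ⟨C, hC⟩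
    have hpair : Measurable (fun p : 𝒳 × Bool => (g p.1, p.2)) :=
      (hg.comp measurable_fst).prodMk measurable_snd
    have hint : Measurable (fun p : I01 × Bool => (lbl p.2 - (p.1 : ℝ)) * w p.1) :=
      (((measurable_from_top (f := lbl)).comp measurable_snd).sub
        (measurable_subtype_coe.comp measurable_fst)).mul (hw.comp measurable_fst)
    unfold calErr predDist
    rw [integral_map hpair.aemeasurable hint.aestronglyMeasurable]
    let W : ℝ → ℝ := fun x => w (Set.projIcc (0 : ℝ) 1 zero_le_one x)
    have hW : Measurable W := hw.comp continuous_projIcc.measurable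
    let E := D[(fun p : 𝒳 × Bool => lbl p.2) |
        MeasurableSpace.comap (fun p : 𝒳 × Bool => f p.1) inferInstance]
    let h : 𝒳 × Bool → ℝ := fun p => W (E p)
    have hh : StronglyMeasurable[MeasurableSpace.comap (fun p : 𝒳 × Bool => f p.1)
        inferInstance] h :=
      (hW.comp stronglyMeasurable_condExp.measurable).stronglyMeasurable
    have hhb : ∀ p, ‖h p‖ ≤ C := fun p => hC _
    have hYh : Integrable ((fun p : 𝒳 × Bool => lbl p.2) * h) D :=
      hYint.mul_bdd (c := C) (hh.mono hm).aestronglyMeasurable (Filter.Eventually.of_forall hhb)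
    have hEint : Integrable E D := integrable_condExp
    have hEh : Integrable (E * h) D :=
      hEint.mul_bdd (c := C) (hh.mono hm).aestronglyMeasurable
        (Filter.Eventually.of_forall hhb)
    have hpull : _ =ᵐ[D] E * h := condExp_mul_of_stronglyMeasurable_right hh hYh hYint
    have heq : ∫ p, ((fun p : 𝒳 × Bool => lbl p.2) * h) p ∂D = ∫ p, (E * h) p ∂D := by
      rw [← integral_condExp hm]
      exact integral_congr_ae hpull
    have hae : (fun p : 𝒳 × Bool => (lbl p.2 - (g p.1 : ℝ)) * w (g p.1)) =ᵐ[D]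
        fun p => ((fun p : 𝒳 × Bool => lbl p.2) * h) p - (E * h) p := by
      filter_upwards [hcond] with p hp
      have h1 : h p = w (g p.1) := by
        change W (E p) = _
        have : E p = (g p.1 : ℝ) := hp.symm
        rw [this]
        change w (Set.projIcc (0 : ℝ) 1 zero_le_one _) = _
        rw [Set.projIcc_val]
      have h2 : E p = (g p.1 : ℝ) := hp.symm
      simp only [Pi.mul_apply, h1, h2]
      ring
    rw [integral_congr_ae hae, integral_sub hYh hEh, heq, sub_self]
  have hsymm : (∫ p, |(g p.1 : ℝ) - (f p.1 : ℝ)| ∂D)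
      = (∫ p, |(f p.1 : ℝ) - (g p.1 : ℝ)| ∂D) := by
    simp only [abs_sub_comm]
  refine ⟨hcal, hsymm, ?_⟩
  rw [hsymm]
  refine csInf_le ⟨0, ?_⟩ ⟨g, hcal, rfl⟩
  rintro x ⟨k, -, rfl⟩
  exact integral_nonneg fun p => abs_nonneg _
end
end

section
/- For every probability distribution Γ over [0,1]×{0,1}: udCE(Γ) ≤ intCE(Γ) ≤ SintCE(Γ) ≤ 6·√(ldCE(Γ)). -/
open MeasureTheory Set

noncomputable section

lemma meas_lbl : Measurable lbl := measurable_of_finite _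

lemma lbl_nonneg (y : Bool) : 0 ≤ lbl y := by cases y <;> simp [lbl]
lemma lbl_le_one (y : Bool) : lbl y ≤ 1 := by cases y <;> simp [lbl]

lemma int_bdd {α : Type*} [MeasurableSpace α] (μ : Measure α) [IsFiniteMeasure μ] {f : α → ℝ}
    (hf : Measurable f) (C : ℝ) (h : ∀ x, |f x| ≤ C) : Integrable f μ :=
  Integrable.of_bound hf.aestronglyMeasurable C (Filter.Eventually.of_forall h)

lemma meas_ind {α : Type*} [MeasurableSpace α] {f g : α → ℝ} {A : Set ℝ}
    (hA : MeasurableSet A) (hf : Measurable f) (hg : Measurable g) :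
    Measurable (fun p => Set.indicator A (fun _ => f p) (g p)) := by
  have : (fun p => Set.indicator A (fun _ => f p) (g p)) = Set.indicator (g ⁻¹' A) f := by
    ext p; by_cases h : g p ∈ A <;> simp [Set.indicator, h]
  rw [this]; exact hf.indicator (hg hA)

lemma abs_ind_le {A : Set ℝ} {c x C : ℝ} (hC : |c| ≤ C) :
    |Set.indicator A (fun _ => c) x| ≤ C := by
  unfold Set.indicator
  split_ifs
  · exact hC
  · simpa using (abs_nonneg c).trans hC

lemma int_ind {α : Type*} [MeasurableSpace α] (μ : Measure α) [IsFiniteMeasure μ] {f g : α → ℝ}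
    {A : Set ℝ} (hA : MeasurableSet A) (hf : Measurable f) (hg : Measurable g)
    (C : ℝ) (h : ∀ x, |f x| ≤ C) :
    Integrable (fun p => Set.indicator A (fun _ => f p) (g p)) μ :=
  int_bdd μ (meas_ind hA hf hg) C (fun x => abs_ind_le (h x))

lemma meas_v : Measurable (fun p : I01 × Bool => (p.1 : ℝ)) :=
  measurable_subtype_coe.comp measurable_fst

lemma meas_y : Measurable (fun p : I01 × Bool => lbl p.2) := meas_lbl.comp measurable_snd

lemma abs_lbl_sub (y : Bool) (v : I01) : |lbl y - (v : ℝ)| ≤ 1 := by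
  have := lbl_nonneg y; have := lbl_le_one y; have := v.2.1; have := v.2.2
  rw [abs_le]; constructor <;> linarith

lemma abs_sub_lbl (y : Bool) (v : I01) : |(v : ℝ) - lbl y| ≤ 1 := by
  rw [abs_sub_comm]; exact abs_lbl_sub y v

lemma abs_I_sub (u v : I01) : |(u : ℝ) - v| ≤ 1 := by
  have := u.2.1; have := u.2.2; have := v.2.1; have := v.2.2
  rw [abs_le]; constructor <;> linarith

lemma part_exists (P : IntervalPartition) (v : I01) : ∃ j, (v : ℝ) ∈ P.piece j := by
  have : (v : ℝ) ∈ (⋃ j, P.piece j) := by rw [P.cover]; exact v.2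
  simpa using this

lemma part_unique (P : IntervalPartition) {x : ℝ} {i j} (hi : x ∈ P.piece i)
    (hj : x ∈ P.piece j) : i = j := by
  by_contra h
  exact Set.disjoint_left.1 (P.disj i j h) hi hj

lemma part_sum (P : IntervalPartition) (v : I01) (g : Fin P.m → ℝ) {j} (hj : (v : ℝ) ∈ P.piece j) :
    ∑ i, Set.indicator (P.piece i) (fun _ => g i) (v : ℝ) = g j := by
  rw [Finset.sum_eq_single j]
  · simp [hj]
  · intro i _ hi
    rw [Set.indicator_of_notMem]
    intro h; exact hi (part_unique P h hj)
  · simp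

lemma part_meas (P : IntervalPartition) (j) : MeasurableSet (P.piece j) :=
  (P.ordConn j).measurableSet

lemma part_sub (P : IntervalPartition) (j) : P.piece j ⊆ Set.Icc 0 1 := by
  rw [← P.cover]; exact Set.subset_iUnion _ _

lemma udCE_bdd (Γ : Measure (I01 × Bool)) : BddBelow {x | ∃ κ : I01 → I01, Measurable κ ∧
    PerfCal (Γ.map (fun p => (κ p.1, p.2))) ∧
    x = ∫ p, |(p.1 : ℝ) - (κ p.1 : ℝ)| ∂Γ} := by
  refine ⟨0, ?_⟩
  rintro x ⟨κ, -, -, rfl⟩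
  exact integral_nonneg (fun _ => abs_nonneg _)

lemma ud_le (Γ : Measure (I01 × Bool)) [IsProbabilityMeasure Γ] (P : IntervalPartition) :
    udCE Γ ≤ binnedECE Γ P + avgWidth Γ P := by
  set m : Fin P.m → ℝ := fun j => ∫ p, Set.indicator (P.piece j) (fun _ => (1:ℝ)) (p.1 : ℝ) ∂Γ with hm
  set b : Fin P.m → ℝ := fun j => ∫ p, Set.indicator (P.piece j) (fun _ => lbl p.2) (p.1 : ℝ) ∂Γ with hb
  have hi1 : ∀ j, Integrable (fun p : I01 × Bool => Set.indicator (P.piece j) (fun _ => (1:ℝ)) (p.1 : ℝ)) Γ :=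
    fun j => int_ind Γ (part_meas P j) measurable_const meas_v 1 (by simp)
  have hib : ∀ j, Integrable (fun p : I01 × Bool => Set.indicator (P.piece j) (fun _ => lbl p.2) (p.1 : ℝ)) Γ :=
    fun j => int_ind Γ (part_meas P j) meas_y meas_v 1
      (fun p => by rw [abs_of_nonneg (lbl_nonneg _)]; exact lbl_le_one _)
  have hiv : ∀ j, Integrable (fun p : I01 × Bool => Set.indicator (P.piece j) (fun _ => (p.1:ℝ)) (p.1 : ℝ)) Γ :=
    fun j => int_ind Γ (part_meas P j) meas_v meas_v 1
      (fun p => by rw [abs_of_nonneg p.1.2.1]; exact p.1.2.2)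
  have hb0 : ∀ j, 0 ≤ b j := fun j => integral_nonneg
    (fun p => Set.indicator_nonneg (fun _ _ => lbl_nonneg _) _)
  have hbm : ∀ j, b j ≤ m j := fun j => integral_mono (hib j) (hi1 j)
    (fun p => Set.indicator_le_indicator (lbl_le_one _))
  have hm0 : ∀ j, 0 ≤ m j := fun j => (hb0 j).trans (hbm j)
  set c : Fin P.m → ℝ := fun j => b j / m j with hc
  have hc0 : ∀ j, 0 ≤ c j := fun j => div_nonneg (hb0 j) (hm0 j)
  have hc1 : ∀ j, c j ≤ 1 := fun j => div_le_one_of_le₀ (hbm j) (hm0 j)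
  have hcm : ∀ j, c j * m j = b j := by
    intro j
    rcases eq_or_ne (m j) 0 with h | h
    · have := hb0 j; have := hbm j; rw [h]; linarith
    · simp only [hc]; field_simp
  let κ : I01 → I01 := fun v => Set.projIcc (0:ℝ) 1 zero_le_one
    (∑ j, Set.indicator (P.piece j) (fun _ => c j) (v : ℝ))
  have hκm : Measurable κ := by
    apply continuous_projIcc.measurable.comp
    exact Finset.measurable_sum _ fun j _ =>
      meas_ind (part_meas P j) measurable_const measurable_subtype_coe
  have hκ : ∀ v : I01, ∀ j, (v:ℝ) ∈ P.piece j → (κ v : ℝ) = c j := by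
    intro v j hj
    simp only [κ, part_sum P v c hj]
    rw [Set.projIcc_of_mem _ ⟨hc0 j, hc1 j⟩]
  let cI : Fin P.m → I01 := fun j => ⟨c j, hc0 j, hc1 j⟩
  have hκ' : ∀ v : I01, ∀ j, (v:ℝ) ∈ P.piece j → κ v = cI j :=
    fun v j hj => Subtype.ext (hκ v j hj)
  have hle : udCE Γ ≤ ∫ p, |(p.1 : ℝ) - (κ p.1 : ℝ)| ∂Γ := by
    refine csInf_le (udCE_bdd Γ) ⟨κ, hκm, ?_, rfl⟩
    rintro w hw ⟨C, hC⟩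
    unfold calErr
    have hmap : Measurable (fun p : I01 × Bool => (κ p.1, p.2)) :=
      (hκm.comp measurable_fst).prodMk measurable_snd
    rw [integral_map hmap.aemeasurable]
    swap
    · exact ((meas_y.sub meas_v).mul (hw.comp measurable_fst)).aestronglyMeasurable
    have e : (fun p : I01 × Bool => (lbl p.2 - (κ p.1 : ℝ)) * w (κ p.1)) =
        fun p => ∑ j, w (cI j) * (Set.indicator (P.piece j) (fun _ => lbl p.2) (p.1 : ℝ)
          - c j * Set.indicator (P.piece j) (fun _ => (1:ℝ)) (p.1 : ℝ)) := by
      ext p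
      obtain ⟨j, hj⟩ := part_exists P p.1
      rw [hκ _ j hj, hκ' _ j hj, ← part_sum P p.1 (fun j => (lbl p.2 - c j) * w (cI j)) hj]
      refine Finset.sum_congr rfl fun i _ => ?_
      by_cases h : (p.1:ℝ) ∈ P.piece i <;> simp [h]; ring
    simp only [e]
    rw [integral_finsetSum]
    · refine Finset.sum_eq_zero fun j _ => ?_
      rw [integral_const_mul, integral_sub (hib j) ((hi1 j).const_mul _), integral_const_mul]
      change w (cI j) * (b j - c j * m j) = 0
      rw [hcm]; ring
    · intro j _
      exact ((hib j).sub ((hi1 j).const_mul _)).const_mul _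
  refine hle.trans ?_
  have hid : ∀ j, Integrable (fun p : I01 × Bool => Set.indicator (P.piece j) (fun _ => |(p.1:ℝ) - c j|) (p.1 : ℝ)) Γ :=
    fun j => int_ind Γ (part_meas P j) ((meas_v.sub_const _).abs) meas_v 1
      (fun p => by rw [abs_abs]; exact abs_I_sub p.1 (cI j))
  have e : (fun p : I01 × Bool => |(p.1:ℝ) - κ p.1|) =
        fun p => ∑ j, Set.indicator (P.piece j) (fun _ => |(p.1:ℝ) - c j|) (p.1 : ℝ) := by
    ext p
    obtain ⟨j, hj⟩ := part_exists P p.1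
    rw [hκ _ j hj, ← part_sum P p.1 (fun j => |(p.1:ℝ) - c j|) hj]
  simp only [e]
  rw [integral_finsetSum _ (fun j _ => hid j)]
  unfold binnedECE avgWidth
  rw [← Finset.sum_add_distrib]
  refine Finset.sum_le_sum fun j _ => ?_
  change _ ≤ _ + m j * _
  set D := Metric.diam (P.piece j) with hD
  have hbd : Bornology.IsBounded (P.piece j) := Metric.isBounded_Icc (0:ℝ) 1 |>.subset (part_sub P j)
  set a := ∫ p, Set.indicator (P.piece j) (fun _ => (p.1:ℝ)) (p.1 : ℝ) ∂Γ with ha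
  have hab : ∫ p, Set.indicator (P.piece j) (fun _ => ((p.1 : ℝ) - lbl p.2)) (p.1 : ℝ) ∂Γ = a - b j := by
    rw [ha, hb, ← integral_sub (hiv j) (hib j)]
    congr 1; ext p
    by_cases h : (p.1:ℝ) ∈ P.piece j <;> simp [h]
  rw [hab]
  rcases eq_or_lt_of_le (hm0 j) with h0 | h0
  · have : ∫ p, Set.indicator (P.piece j) (fun _ => |(p.1:ℝ) - c j|) (p.1 : ℝ) ∂Γ ≤ m j :=
      integral_mono (hid j) (hi1 j) (fun p => Set.indicator_le_indicator (abs_I_sub p.1 (cI j)))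
    rw [← h0] at this ⊢
    have := abs_nonneg (a - b j)
    linarith
  · have key : ∀ v ∈ P.piece j, |v * m j - a| ≤ D * m j := by
      intro v hv
      have h1 : ∀ s : ℝ, ∫ p, s * Set.indicator (P.piece j) (fun _ => (1:ℝ)) ((p : I01 × Bool).1 : ℝ) ∂Γ = s * m j := by
        intro s; rw [integral_const_mul]
      have hdist : ∀ x ∈ P.piece j, |v - x| ≤ D := fun x hx => by
        rw [← Real.dist_eq]; exact Metric.dist_le_diam_of_mem hbd hv hx
      rw [abs_le]
      constructor
      · have : a ≤ (v + D) * m j := by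
          rw [← h1, ha]
          refine integral_mono (hiv j) ((hi1 j).const_mul _) fun p => ?_
          by_cases h : (p.1:ℝ) ∈ P.piece j
          · have := (abs_le.1 (hdist _ h)).1
            simp [h]; linarith
          · simp [h]
        linarith
      · have : (v - D) * m j ≤ a := by
          rw [← h1, ha]
          refine integral_mono ((hi1 j).const_mul _) (hiv j) fun p => ?_
          by_cases h : (p.1:ℝ) ∈ P.piece j
          · have := (abs_le.1 (hdist _ h)).2
            simp [h]; linarith
          · simp [h]
        linarith
    have key2 : ∀ v ∈ P.piece j, |v - c j| ≤ D + |a - b j| / m j := by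
      intro v hv
      rw [← sub_le_iff_le_add, ← mul_le_mul_iff_left₀ h0]
      have h2 : |v - c j| * m j = |(v * m j - a) + (a - b j)| := by
        rw [← hcm j, ← abs_of_pos h0, ← abs_mul, abs_of_pos h0]; congr 1; ring
      have h3 := abs_add_le (v * m j - a) (a - b j)
      have h4 := key v hv
      rw [sub_mul, div_mul_cancel₀ _ h0.ne', h2]; linarith
    calc _ ≤ ∫ p, (D + |a - b j| / m j) * Set.indicator (P.piece j) (fun _ => (1:ℝ)) ((p : I01 × Bool).1 : ℝ) ∂Γ := by
          refine integral_mono (hid j) ((hi1 j).const_mul _) fun p => ?_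
          by_cases h : (p.1:ℝ) ∈ P.piece j
          · have := key2 _ h
            simpa [h] using this
          · simp [h]
      _ = (D + |a - b j| / m j) * m j := integral_const_mul _ _
      _ = |a - b j| + m j * D := by rw [add_mul, div_mul_cancel₀ _ h0.ne']; ring

def trivPart : IntervalPartition where
  m := 1
  piece := fun _ => Set.Icc 0 1
  ordConn := fun _ => Set.ordConnected_Icc
  disj := fun i j h => absurd (Subsingleton.elim i j) h
  cover := Set.iUnion_const _

lemma ud_le_int (Γ : Measure (I01 × Bool)) [IsProbabilityMeasure Γ] : udCE Γ ≤ intCE Γ := by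
  refine le_csInf ⟨_, trivPart, rfl⟩ ?_
  rintro x ⟨P, rfl⟩
  exact ud_le Γ P
/-- bin term -/
def bt (Γ : Measure (I01 × Bool)) (ε r : ℝ) (j : ℤ) : ℝ :=
  ∫ p, Set.indicator (Set.Ico (r + (j : ℝ) * ε) (r + ((j : ℝ) + 1) * ε))
      (fun _ => (lbl p.2 - (p.1 : ℝ))) (p.1 : ℝ) ∂Γ

lemma mem_bin {ε : ℝ} (hε : 0 < ε) (r x : ℝ) (j : ℤ) :
    x ∈ Set.Ico (r + (j : ℝ) * ε) (r + ((j : ℝ) + 1) * ε) ↔ ⌊(x - r) / ε⌋ = j := by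
  rw [Int.floor_eq_iff, le_div_iff₀ hε, div_lt_iff₀ hε, Set.mem_Ico]
  constructor <;> rintro ⟨h1, h2⟩ <;> constructor <;> linarith

lemma bin_range {ε : ℝ} (hε : 0 < ε) {N : ℕ} (hN : N * ε = 1) {r : ℝ} (hr : r ∈ Set.Ico 0 ε)
    {x : ℝ} (hx : x ∈ Set.Icc (0:ℝ) 1) : ⌊(x - r) / ε⌋ ∈ Finset.Icc (-1 : ℤ) N := by
  rw [Finset.mem_Icc]
  constructor
  · rw [Int.le_floor, le_div_iff₀ hε]; push_cast; linarith [hr.1, hr.2, hx.1]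
  · rw [← Int.lt_add_one_iff, Int.floor_lt, div_lt_iff₀ hε]
    push_cast; linarith [hr.1, hr.2, hx.2]

lemma bt_abs_le (Γ : Measure (I01 × Bool)) [IsProbabilityMeasure Γ] (ε r : ℝ) (j : ℤ) :
    |bt Γ ε r j| ≤ 1 := by
  have := norm_integral_le_of_norm_le_const (μ := Γ) (C := 1) (f := fun p =>
    Set.indicator (Set.Ico (r + (j : ℝ) * ε) (r + ((j : ℝ) + 1) * ε))
      (fun _ => (lbl p.2 - (p.1 : ℝ))) (p.1 : ℝ))
    (Filter.Eventually.of_forall fun p => abs_ind_le (abs_lbl_sub p.2 p.1))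
  simpa [bt] using this

lemma bt_zero (Γ : Measure (I01 × Bool)) {ε : ℝ} (hε : 0 < ε) {N : ℕ} (hN : N * ε = 1)
    {r : ℝ} (hr : r ∈ Set.Ico 0 ε) (j : ℤ) (hj : j ∉ Finset.Icc (-1 : ℤ) N) : bt Γ ε r j = 0 := by
  unfold bt
  have : ∀ p : I01 × Bool, Set.indicator (Set.Ico (r + (j : ℝ) * ε) (r + ((j : ℝ) + 1) * ε))
      (fun _ => (lbl p.2 - (p.1 : ℝ))) (p.1 : ℝ) = 0 := by
    intro p
    rw [Set.indicator_of_notMem]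
    rw [mem_bin hε]
    rintro rfl
    exact hj (bin_range hε hN hr p.1.2)
  simp [this]

lemma tsum_bt (Γ : Measure (I01 × Bool)) {ε : ℝ} (hε : 0 < ε) {N : ℕ} (hN : N * ε = 1)
    {r : ℝ} (hr : r ∈ Set.Ico 0 ε) :
    ∑' j : ℤ, |bt Γ ε r j| = ∑ j ∈ Finset.Icc (-1 : ℤ) N, |bt Γ ε r j| :=
  tsum_eq_sum fun j hj => by rw [bt_zero Γ hε hN hr j hj, abs_zero]

lemma RintCE_eq (Γ : Measure (I01 × Bool)) {ε : ℝ} (hε : 0 < ε) {N : ℕ} (hN : N * ε = 1) :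
    RintCE Γ ε = (1 / ε) * ∫ r in Set.Ico (0 : ℝ) ε, ∑ j ∈ Finset.Icc (-1 : ℤ) N, |bt Γ ε r j| := by
  unfold RintCE
  congr 1
  exact setIntegral_congr_fun measurableSet_Ico fun r hr => tsum_bt Γ hε hN hr

lemma bt_meas (Γ : Measure (I01 × Bool)) [IsProbabilityMeasure Γ] (ε : ℝ) (j : ℤ) :
    Measurable (fun r => bt Γ ε r j) := by
  unfold bt
  have : StronglyMeasurable (fun q : ℝ × (I01 × Bool) =>
      Set.indicator (Set.Ico (q.1 + (j : ℝ) * ε) (q.1 + ((j : ℝ) + 1) * ε))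
      (fun _ => (lbl q.2.2 - (q.2.1 : ℝ))) (q.2.1 : ℝ)) := by
    have e : (fun q : ℝ × (I01 × Bool) =>
      Set.indicator (Set.Ico (q.1 + (j : ℝ) * ε) (q.1 + ((j : ℝ) + 1) * ε))
      (fun _ => (lbl q.2.2 - (q.2.1 : ℝ))) (q.2.1 : ℝ)) =
      fun q => Set.indicator (Set.Ico ((j : ℝ) * ε) (((j : ℝ) + 1) * ε))
      (fun _ => (lbl q.2.2 - (q.2.1 : ℝ))) ((q.2.1 : ℝ) - q.1) := by
      ext q
      unfold Set.indicator
      congr 1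
      simp only [Set.mem_Ico, eq_iff_iff]
      constructor <;> rintro ⟨h1, h2⟩ <;> constructor <;> linarith
    rw [e]
    exact (meas_ind measurableSet_Ico ((meas_y.sub meas_v).comp measurable_snd)
      ((meas_v.comp measurable_snd).sub measurable_fst)).stronglyMeasurable
  exact this.integral_prod_right'.measurable

lemma int_bdd_below (Γ : Measure (I01 × Bool)) :
    BddBelow {x | ∃ P : IntervalPartition, x = binnedECE Γ P + avgWidth Γ P} := by
  refine ⟨0, ?_⟩
  rintro x ⟨P, rfl⟩
  refine add_nonneg (Finset.sum_nonneg fun _ _ => abs_nonneg _) (Finset.sum_nonneg fun _ _ =>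
    mul_nonneg (integral_nonneg fun p => ?_) Metric.diam_nonneg)
  exact Set.indicator_nonneg (fun _ _ => zero_le_one) _

/-- shifted grid partition -/
def gridPart {ε : ℝ} (hε : 0 < ε) {N : ℕ} (hN : N * ε = 1) {r : ℝ} (hr : r ∈ Set.Ico 0 ε) :
    IntervalPartition where
  m := (Finset.Icc (-1 : ℤ) N).card
  piece := fun i => Set.Ico (r + ((((Finset.Icc (-1 : ℤ) N).equivFin.symm i : ℤ)) : ℝ) * ε)
    (r + ((((Finset.Icc (-1 : ℤ) N).equivFin.symm i : ℤ) : ℝ) + 1) * ε) ∩ Set.Icc 0 1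
  ordConn := fun _ => Set.ordConnected_Ico.inter Set.ordConnected_Icc
  disj := by
    intro i j hij
    rw [Set.disjoint_left]
    rintro x ⟨h1, -⟩ ⟨h2, -⟩
    rw [mem_bin hε] at h1 h2
    apply hij
    apply (Finset.Icc (-1 : ℤ) N).equivFin.symm.injective
    apply Subtype.ext
    rw [← h1, ← h2]
  cover := by
    ext x
    simp only [Set.mem_iUnion, Set.mem_inter_iff]
    constructor
    · rintro ⟨_, _, h⟩; exact h
    · intro hx
      refine ⟨(Finset.Icc (-1 : ℤ) N).equivFin ⟨_, bin_range hε hN hr hx⟩, ?_, hx⟩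
      rw [mem_bin hε]; simp

lemma int_le_grid (Γ : Measure (I01 × Bool)) [IsProbabilityMeasure Γ] {ε : ℝ} (hε : 0 < ε) {N : ℕ}
    (hN : N * ε = 1) {r : ℝ} (hr : r ∈ Set.Ico 0 ε) :
    intCE Γ ≤ ∑ j ∈ Finset.Icc (-1 : ℤ) N, |bt Γ ε r j| + ε := by
  refine (csInf_le (int_bdd_below Γ) ⟨gridPart hε hN hr, rfl⟩).trans ?_
  set P := gridPart hε hN hr with hP
  have hi1 : ∀ j, Integrable (fun p : I01 × Bool => Set.indicator (P.piece j) (fun _ => (1:ℝ)) (p.1 : ℝ)) Γ :=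
    fun j => int_ind Γ (part_meas P j) measurable_const meas_v 1 (by simp)
  refine add_le_add ?_ ?_
  · refine le_of_eq ?_
    unfold binnedECE
    rw [← Finset.sum_coe_sort (Finset.Icc (-1 : ℤ) N) (fun j => |bt Γ ε r j|), ← Equiv.sum_comp (Finset.Icc (-1 : ℤ) N).equivFin.symm]
    refine Finset.sum_congr rfl fun i _ => ?_
    rw [bt, ← abs_neg, ← integral_neg]
    congr 2
    ext p
    have hpi : P.piece i = Set.Ico (r + ((((Finset.Icc (-1 : ℤ) N).equivFin.symm i : ℤ)) : ℝ) * ε)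
      (r + ((((Finset.Icc (-1 : ℤ) N).equivFin.symm i : ℤ) : ℝ) + 1) * ε) ∩ Set.Icc 0 1 := rfl
    rw [hpi]
    have := p.1.2
    by_cases h : (p.1 : ℝ) ∈ Set.Ico (r + ((((Finset.Icc (-1 : ℤ) N).equivFin.symm i : ℤ)) : ℝ) * ε)
      (r + ((((Finset.Icc (-1 : ℤ) N).equivFin.symm i : ℤ) : ℝ) + 1) * ε)
    · rw [Set.indicator_of_mem (Set.mem_inter h this), Set.indicator_of_mem h]; ring
    · rw [Set.indicator_of_notMem (fun h' => h h'.1), Set.indicator_of_notMem h, neg_zero]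
  · unfold avgWidth
    calc _ ≤ ∑ j : Fin P.m, (∫ p, Set.indicator (P.piece j) (fun _ => (1 : ℝ)) ((p : I01 × Bool).1 : ℝ) ∂Γ) * ε := by
          refine Finset.sum_le_sum fun j _ => mul_le_mul_of_nonneg_left ?_
            (integral_nonneg fun p => Set.indicator_nonneg (fun _ _ => zero_le_one) _)
          refine Metric.diam_le_of_forall_dist_le hε.le ?_
          rintro x ⟨hx, -⟩ y ⟨hy, -⟩
          rw [Real.dist_eq, abs_le]
          constructor <;> nlinarith [hx.1, hx.2, hy.1, hy.2]
      _ = (∫ p, (∑ j : Fin P.m, Set.indicator (P.piece j) (fun _ => (1 : ℝ)) ((p : I01 × Bool).1 : ℝ)) ∂Γ) * ε := by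
          rw [integral_finsetSum _ fun j _ => hi1 j, Finset.sum_mul]
      _ = 1 * ε := by
          congr 1
          have : ∀ p : I01 × Bool, ∑ j : Fin P.m, Set.indicator (P.piece j) (fun _ => (1 : ℝ)) (p.1 : ℝ) = 1 := by
            intro p
            obtain ⟨j, hj⟩ := part_exists P p.1
            exact part_sum P p.1 (fun _ => 1) hj
          simp [this]
      _ = ε := one_mul _
      _ ≤ ε := le_rfl

lemma int_le_R (Γ : Measure (I01 × Bool)) [IsProbabilityMeasure Γ] {ε : ℝ} (hε : 0 < ε) {N : ℕ}
    (hN : N * ε = 1) : intCE Γ ≤ RintCE Γ ε + ε := by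
  rw [RintCE_eq Γ hε hN, ← sub_le_iff_le_add, one_div, inv_mul_eq_div, le_div_iff₀ hε]
  have h1 : ∫ r in Set.Ico (0 : ℝ) ε, (intCE Γ - ε) = (intCE Γ - ε) * ε := by
    simp [hε.le, mul_comm]
  rw [← h1]
  refine setIntegral_mono_on ?_ ?_ measurableSet_Ico fun r hr => ?_
  · simp
  · refine int_bdd _ (Finset.measurable_sum _ fun j _ => (bt_meas Γ ε j).abs)
      (∑ j ∈ Finset.Icc (-1 : ℤ) N, 1) fun r => ?_
    refine (Finset.abs_sum_le_sum_abs _ _).trans (Finset.sum_le_sum fun j _ => ?_)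
    rw [abs_abs]; exact bt_abs_le Γ ε r j
  · have := int_le_grid Γ hε hN hr
    linarith

lemma pow_hN (k : ℕ) : ((2 ^ k : ℕ) : ℝ) * (1 / 2 : ℝ) ^ k = 1 := by
  push_cast; rw [← mul_pow]; norm_num

lemma int_le_S (Γ : Measure (I01 × Bool)) [IsProbabilityMeasure Γ] : intCE Γ ≤ SintCE Γ :=
  le_ciInf fun k => int_le_R Γ (by positivity) (pow_hN k)

/- Part 3 -/
lemma floor_integral {ε : ℝ} (hε : 0 < ε) (v : ℝ) :
    ∫ r in Set.Ico (0 : ℝ) ε, (⌊(v - r) / ε⌋ : ℝ) = v - ε := by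
  set n := ⌊v / ε⌋ with hn
  have h1 : n * ε ≤ v := by rw [← le_div_iff₀ hε]; exact Int.floor_le _
  have h2 : v < (n + 1) * ε := by rw [← div_lt_iff₀ hε]; exact Int.lt_floor_add_one _
  have e : ∫ r in Set.Ico (0 : ℝ) ε, (⌊(v - r) / ε⌋ : ℝ) =
      ∫ r in Set.Ico (0 : ℝ) ε, (((n : ℝ) - 1) + Set.indicator (Set.Iic (v - n * ε)) (fun _ => (1:ℝ)) r) := by
    refine setIntegral_congr_fun measurableSet_Ico fun r hr => ?_
    by_cases h : r ≤ v - n * ε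
    · rw [Set.indicator_of_mem (show r ∈ Set.Iic _ from h)]
      have : ⌊(v - r) / ε⌋ = n := by
        rw [← mem_bin hε]; constructor <;> linarith [hr.1, hr.2]
      rw [this]; ring
    · rw [Set.indicator_of_notMem (show r ∉ Set.Iic _ from h)]
      have : ⌊(v - r) / ε⌋ = n - 1 := by
        rw [← mem_bin hε]; push_cast; constructor <;> linarith [hr.1, hr.2]
      rw [this]; push_cast; ring
  rw [e, integral_add (by simp) ((integrable_const _).indicator measurableSet_Iic),
    setIntegral_indicator measurableSet_Iic]
  have : Set.Ico 0 ε ∩ Set.Iic (v - n * ε) = Set.Icc 0 (v - n * ε) := by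
    ext x; simp only [Set.mem_inter_iff, Set.mem_Ico, Set.mem_Iic, Set.mem_Icc]
    constructor
    · rintro ⟨⟨a, b⟩, c⟩; exact ⟨a, c⟩
    · rintro ⟨a, c⟩; exact ⟨⟨a, by linarith⟩, c⟩
  rw [this]
  simp [hε.le, sub_nonneg.2 h1]
  ring

lemma floor_meas (ε v : ℝ) : Measurable (fun r : ℝ => (⌊(v - r) / ε⌋ : ℝ)) := by
  have : Measurable (fun r : ℝ => ⌊(v - r) / ε⌋) :=
    Int.measurable_floor.comp ((measurable_const.sub measurable_id).div_const _)
  exact (measurable_of_countable (fun n : ℤ => (n : ℝ))).comp this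

lemma floor_diff (a b : ℝ) : |(⌊a⌋ : ℝ) - ⌊b⌋| ≤ |a - b| + 1 := by
  have := Int.floor_le a; have := Int.floor_le b
  have := Int.lt_floor_add_one a; have := Int.lt_floor_add_one b
  have := abs_le.1 (le_refl |a - b|)
  rw [abs_le]; constructor <;> linarith [this.1, this.2]

lemma floor_integrable {ε : ℝ} (hε : 0 < ε) (v : ℝ) :
    IntegrableOn (fun r : ℝ => (⌊(v - r) / ε⌋ : ℝ)) (Set.Ico 0 ε) := by
  refine Integrable.of_bound (floor_meas ε v).aestronglyMeasurable (|v| / ε + 2) ?_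
  filter_upwards [ae_restrict_mem measurableSet_Ico] with r hr
  have h := floor_diff ((v - r) / ε) 0
  simp only [Int.floor_zero, Int.cast_zero, sub_zero] at h
  rw [Real.norm_eq_abs]
  refine h.trans ?_
  rw [abs_div, abs_of_pos hε]
  have : |v - r| / ε ≤ |v| / ε + 1 := by
    rw [div_add_one hε.ne']
    gcongr
    have := abs_sub v r
    rw [abs_of_nonneg hr.1] at this; linarith [hr.2]
  linarith

lemma floor_abs_integral {ε : ℝ} (hε : 0 < ε) (u v : ℝ) :
    ∫ r in Set.Ico (0 : ℝ) ε, |(⌊(u - r) / ε⌋ : ℝ) - ⌊(v - r) / ε⌋| = |u - v| := by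
  wlog huv : v ≤ u generalizing u v
  · rw [abs_sub_comm u v, ← this v u (le_of_not_ge huv)]
    simp only [abs_sub_comm]
  · rw [abs_of_nonneg (sub_nonneg.2 huv)]
    have : ∀ r, |(⌊(u - r) / ε⌋ : ℝ) - ⌊(v - r) / ε⌋| = (⌊(u - r) / ε⌋ : ℝ) - ⌊(v - r) / ε⌋ := by
      intro r
      apply abs_of_nonneg
      rw [sub_nonneg, Int.cast_le]
      gcongr
    simp only [this]
    rw [integral_sub (floor_integrable hε u) (floor_integrable hε v), floor_integral hε,
      floor_integral hε]
    ring
lemma meas_u3 : Measurable (fun p : I01 × I01 × Bool => (p.1 : ℝ)) :=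
  measurable_subtype_coe.comp measurable_fst

lemma meas_v3 : Measurable (fun p : I01 × I01 × Bool => (p.2.1 : ℝ)) :=
  measurable_subtype_coe.comp (measurable_fst.comp measurable_snd)

lemma meas_y3 : Measurable (fun p : I01 × I01 × Bool => lbl p.2.2) :=
  meas_lbl.comp (measurable_snd.comp measurable_snd)

lemma one_le_abs_floor {a b : ℤ} (h : a ≠ b) : (1 : ℝ) ≤ |(a : ℝ) - b| := by
  have : (1 : ℤ) ≤ |a - b| := Int.one_le_abs (sub_ne_zero.2 h)
  exact_mod_cast this

/-- pointwise bound -/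
lemma pointwise {ε : ℝ} (hε : 0 < ε) (r u v y : ℝ) (hu : |y - u| ≤ 1) (hv : |y - v| ≤ 1)
    (S : Finset ℤ) :
    ∑ j ∈ S, |Set.indicator (Set.Ico (r + (j : ℝ) * ε) (r + ((j : ℝ) + 1) * ε)) (fun _ => y - v) v
      - Set.indicator (Set.Ico (r + (j : ℝ) * ε) (r + ((j : ℝ) + 1) * ε)) (fun _ => y - u) u|
    ≤ |u - v| + 2 * |(⌊(u - r) / ε⌋ : ℝ) - ⌊(v - r) / ε⌋| := by
  have hs : ∀ (x c : ℝ), 0 ≤ c → ∑ j ∈ S, (if ⌊(x - r) / ε⌋ = j then c else 0) ≤ c := by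
    intro x c hc
    rw [Finset.sum_ite_eq]
    split_ifs <;> linarith
  simp only [Set.indicator, mem_bin hε]
  by_cases h : ⌊(u - r) / ε⌋ = ⌊(v - r) / ε⌋
  · rw [h, sub_self, abs_zero, mul_zero, add_zero]
    refine le_trans (Finset.sum_le_sum fun j _ => ?_) (hs v |u - v| (abs_nonneg _))
    split_ifs
    · apply le_of_eq; congr 1; ring
    · simp
  · have h1 := one_le_abs_floor h
    have h2 : ∑ j ∈ S, |(if ⌊(v - r) / ε⌋ = j then y - v else 0) -
        (if ⌊(u - r) / ε⌋ = j then y - u else 0)| ≤ 1 + 1 := by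
      refine le_trans ?_ (add_le_add (hs v 1 zero_le_one) (hs u 1 zero_le_one))
      rw [← Finset.sum_add_distrib]
      refine Finset.sum_le_sum fun j _ => (abs_sub _ _).trans (add_le_add ?_ ?_)
      · split_ifs <;> simp [hv]
      · split_ifs <;> simp [hu]
    have := abs_nonneg (u - v)
    linarith

lemma gmeas (ε : ℝ) : Measurable (fun q : ℝ × (I01 × I01 × Bool) =>
    |(⌊((q.2.1:ℝ) - q.1) / ε⌋ : ℝ) - ⌊((q.2.2.1:ℝ) - q.1) / ε⌋|) := by
  have hc : Measurable (fun n : ℤ => (n : ℝ)) := measurable_of_countable _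
  have h1 : Measurable (fun q : ℝ × (I01 × I01 × Bool) => ⌊((q.2.1:ℝ) - q.1) / ε⌋) :=
    Int.measurable_floor.comp (((meas_u3.comp measurable_snd).sub measurable_fst).div_const _)
  have h2 : Measurable (fun q : ℝ × (I01 × I01 × Bool) => ⌊((q.2.2.1:ℝ) - q.1) / ε⌋) :=
    Int.measurable_floor.comp (((meas_v3.comp measurable_snd).sub measurable_fst).div_const _)
  exact ((hc.comp h1).sub (hc.comp h2)).abs

lemma gbound {ε : ℝ} (hε : 0 < ε) (q : ℝ × (I01 × I01 × Bool)) :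
    |(|(⌊((q.2.1:ℝ) - q.1) / ε⌋ : ℝ) - ⌊((q.2.2.1:ℝ) - q.1) / ε⌋|)| ≤ 1 / ε + 1 := by
  rw [abs_abs]
  refine (floor_diff _ _).trans ?_
  rw [← sub_div, abs_div, abs_of_pos hε]
  gcongr
  have := abs_I_sub q.2.1 q.2.2.1
  rwa [sub_sub_sub_cancel_right]

lemma R_pt (Γ : Measure (I01 × Bool)) {π : Measure (I01 × I01 × Bool)}
    (hπ : π ∈ extSet Γ) {ε : ℝ} (hε : 0 < ε) (N : ℕ) (r : ℝ) :
    ∑ j ∈ Finset.Icc (-1 : ℤ) N, |bt Γ ε r j| ≤ (∫ p, |(p.1 : ℝ) - (p.2.1 : ℝ)| ∂π) +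
      2 * ∫ p, |(⌊((p.1:ℝ) - r) / ε⌋ : ℝ) - ⌊((p.2.1:ℝ) - r) / ε⌋| ∂π := by
  obtain ⟨hprob, hmap, hcal⟩ := hπ
  have hdi : Integrable (fun p : I01 × I01 × Bool => |(p.1 : ℝ) - (p.2.1 : ℝ)|) π :=
    int_bdd π (meas_u3.sub meas_v3).abs 1 fun p => by rw [abs_abs]; exact abs_I_sub _ _
  have hgi : ∀ r : ℝ, Integrable (fun p : I01 × I01 × Bool =>
      |(⌊((p.1:ℝ) - r) / ε⌋ : ℝ) - ⌊((p.2.1:ℝ) - r) / ε⌋|) π := by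
    intro r
    have hm : Measurable (fun p : I01 × I01 × Bool => (r, p)) := measurable_const.prodMk measurable_id
    have hg := (gmeas ε).comp hm
    have hb : ∀ p : I01 × I01 × Bool, |(|(⌊((p.1:ℝ) - r) / ε⌋ : ℝ) - ⌊((p.2.1:ℝ) - r) / ε⌋|)| ≤ 1 / ε + 1 := by
      intro p
      have := gbound hε (r, p)
      simpa only using this
    simp only [Function.comp_def] at hg
    exact int_bdd π hg _ hb
  obtain ⟨A, hA⟩ : ∃ A : ℤ → Set ℝ, A = fun j : ℤ => Set.Ico (r + (j : ℝ) * ε) (r + ((j : ℝ) + 1) * ε) := ⟨_, rfl⟩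
  have hAm : ∀ j, MeasurableSet (A j) := fun j => by rw [hA]; exact measurableSet_Ico
  have hiv : ∀ j, Integrable (fun p : I01 × I01 × Bool =>
      Set.indicator (A j) (fun _ => lbl p.2.2 - (p.2.1 : ℝ)) (p.2.1 : ℝ)) π := fun j =>
    int_ind π (hAm _) (meas_y3.sub meas_v3) meas_v3 1 fun p => abs_lbl_sub _ _
  have hiu : ∀ j, Integrable (fun p : I01 × I01 × Bool =>
      Set.indicator (A j) (fun _ => lbl p.2.2 - (p.1 : ℝ)) (p.1 : ℝ)) π := fun j =>
    int_ind π (hAm _) (meas_y3.sub meas_u3) meas_u3 1 fun p => abs_lbl_sub _ _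
  have hb : ∀ j, bt Γ ε r j = ∫ p, (Set.indicator (A j) (fun _ => lbl p.2.2 - (p.2.1 : ℝ)) (p.2.1 : ℝ)
      - Set.indicator (A j) (fun _ => lbl p.2.2 - (p.1 : ℝ)) (p.1 : ℝ)) ∂π := by
    intro j
    rw [integral_sub (hiv j) (hiu j)]
    have h0 : ∫ p, Set.indicator (A j) (fun _ => lbl p.2.2 - (p.1 : ℝ)) (p.1 : ℝ) ∂π = 0 := by
      have hw : Measurable (fun t : I01 => Set.indicator (A j) (fun _ => (1:ℝ)) (t : ℝ)) :=
        meas_ind (hAm _) measurable_const measurable_subtype_coe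
      have := hcal (fun t => Set.indicator (A j) (fun _ => (1:ℝ)) (t : ℝ)) hw
        ⟨1, fun t => abs_ind_le (by simp)⟩
      unfold calErr at this
      have hm3 : Measurable (fun p : I01 × Bool => (lbl p.2 - (p.1 : ℝ)) *
          Set.indicator (A j) (fun _ => (1:ℝ)) (p.1 : ℝ)) :=
        (meas_y.sub meas_v).mul (hw.comp measurable_fst)
      have hm2 : Measurable (fun p : I01 × I01 × Bool => (p.1, p.2.2)) := by fun_prop
      rw [integral_map hm2.aemeasurable hm3.aestronglyMeasurable] at this
      rw [← this]
      congr 1; ext p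
      by_cases h : (p.1 : ℝ) ∈ A j <;> simp [h]
    rw [h0, sub_zero, bt]
    change ∫ p, Set.indicator ((fun j : ℤ => Set.Ico (r + (j : ℝ) * ε) (r + ((j : ℝ) + 1) * ε)) j) (fun _ => (lbl p.2 - (p.1 : ℝ))) (p.1 : ℝ) ∂Γ = _
    rw [← hA]
    conv_lhs => rw [← hmap]
    rw [integral_map]
    · exact (measurable_snd (α := I01) (β := I01 × Bool)).aemeasurable
    · exact (meas_ind (hAm _) (meas_y.sub meas_v) meas_v).aestronglyMeasurable
  calc _ ≤ ∑ j ∈ Finset.Icc (-1 : ℤ) N, ∫ p, |Set.indicator (A j) (fun _ => lbl p.2.2 - (p.2.1 : ℝ)) (p.2.1 : ℝ)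
      - Set.indicator (A j) (fun _ => lbl p.2.2 - (p.1 : ℝ)) (p.1 : ℝ)| ∂π := by
        refine Finset.sum_le_sum fun j _ => ?_
        rw [hb]; exact abs_integral_le_integral_abs
    _ = ∫ p, ∑ j ∈ Finset.Icc (-1 : ℤ) N, |Set.indicator (A j) (fun _ => lbl p.2.2 - (p.2.1 : ℝ)) (p.2.1 : ℝ)
      - Set.indicator (A j) (fun _ => lbl p.2.2 - (p.1 : ℝ)) (p.1 : ℝ)| ∂π := by
        exact (integral_finsetSum _ fun j _ => ((hiv j).sub (hiu j)).abs).symm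
    _ ≤ ∫ p, (|(p.1 : ℝ) - (p.2.1 : ℝ)| + 2 * |(⌊((p.1:ℝ) - r) / ε⌋ : ℝ) - ⌊((p.2.1:ℝ) - r) / ε⌋|) ∂π := by
        refine integral_mono (integrable_finsetSum _ fun j _ => ((hiv j).sub (hiu j)).abs)
          (hdi.add ((hgi r).const_mul 2)) fun p => ?_
        rw [hA]
        exact pointwise hε r p.1 p.2.1 (lbl p.2.2) (abs_lbl_sub _ _) (abs_lbl_sub _ _) _
    _ = _ := by rw [integral_add hdi ((hgi r).const_mul 2), integral_const_mul]

lemma R_le (Γ : Measure (I01 × Bool)) {π : Measure (I01 × I01 × Bool)}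
    (hπ : π ∈ extSet Γ) {ε : ℝ} (hε : 0 < ε) {N : ℕ} (hN : N * ε = 1) :
    RintCE Γ ε ≤ (1 + 2 / ε) * ∫ p, |(p.1 : ℝ) - (p.2.1 : ℝ)| ∂π := by
  have hprob := hπ.1
  have hpt := R_pt Γ hπ hε N
  set d := ∫ p, |(p.1 : ℝ) - (p.2.1 : ℝ)| ∂π with hd
  have hGI : Integrable (Function.uncurry fun (r : ℝ) (p : I01 × I01 × Bool) =>
      |(⌊((p.1:ℝ) - r) / ε⌋ : ℝ) - ⌊((p.2.1:ℝ) - r) / ε⌋|)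
      ((volume.restrict (Set.Ico (0:ℝ) ε)).prod π) :=
    int_bdd _ (gmeas ε) (1 / ε + 1) fun q => gbound hε q
  have hGl : Integrable (fun r : ℝ => ∫ p, |(⌊((p.1:ℝ) - r) / ε⌋ : ℝ) - ⌊((p.2.1:ℝ) - r) / ε⌋| ∂π)
      (volume.restrict (Set.Ico (0:ℝ) ε)) := hGI.integral_prod_left
  have hswap : ∫ r in Set.Ico (0:ℝ) ε, ∫ p, |(⌊((p.1:ℝ) - r) / ε⌋ : ℝ) - ⌊((p.2.1:ℝ) - r) / ε⌋| ∂π = d := by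
    rw [integral_integral_swap hGI]
    simp only [floor_abs_integral hε, hd]
  rw [RintCE_eq Γ hε hN]
  have hI : ∫ r in Set.Ico (0 : ℝ) ε, ∑ j ∈ Finset.Icc (-1 : ℤ) N, |bt Γ ε r j| ≤ ε * d + 2 * d := by
    calc _ ≤ ∫ r in Set.Ico (0:ℝ) ε, (d + 2 * ∫ p, |(⌊((p.1:ℝ) - r) / ε⌋ : ℝ) - ⌊((p.2.1:ℝ) - r) / ε⌋| ∂π) := by
          refine integral_mono_of_nonneg
            (Filter.Eventually.of_forall fun r => Finset.sum_nonneg fun _ _ => abs_nonneg _) ?_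
            (Filter.Eventually.of_forall hpt)
          exact (integrable_const d).add (hGl.const_mul 2)
      _ = _ := by
          rw [integral_add (integrable_const d) (hGl.const_mul 2), integral_const_mul, hswap]
          simp [hε.le]
  calc _ ≤ (1 / ε) * (ε * d + 2 * d) := by gcongr
    _ = _ := by field_simp

lemma R_nonneg (Γ : Measure (I01 × Bool)) {ε : ℝ} (hε : 0 < ε) : 0 ≤ RintCE Γ ε :=
  mul_nonneg (by positivity) (integral_nonneg fun r => tsum_nonneg fun j => abs_nonneg _)

lemma S_bdd (Γ : Measure (I01 × Bool)) :
    BddBelow (Set.range fun k : ℕ => (RintCE Γ ((1 / 2) ^ k) + (1 / 2) ^ k)) := by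
  refine ⟨0, ?_⟩
  rintro x ⟨k, rfl⟩
  have := R_nonneg Γ (ε := (1/2)^k) (by positivity)
  simp only
  positivity

lemma S_nonneg (Γ : Measure (I01 × Bool)) : 0 ≤ SintCE Γ :=
  Real.iInf_nonneg fun k => add_nonneg (R_nonneg Γ (by positivity)) (by positivity)

lemma S_le_t (Γ : Measure (I01 × Bool)) {π : Measure (I01 × I01 × Bool)}
    (hπ : π ∈ extSet Γ) {t : ℝ} (ht : 0 < t) (ht1 : t ≤ 1)
    (hd : ∫ p, |(p.1 : ℝ) - (p.2.1 : ℝ)| ∂π ≤ t ^ 2) : SintCE Γ ≤ 4 * t := by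
  obtain ⟨k, hk1, hk2⟩ := exists_nat_pow_near_of_lt_one ht ht1 (y := (1/2 : ℝ)) (by norm_num) (by norm_num)
  refine (ciInf_le (S_bdd Γ) k).trans ?_
  have hR := R_le Γ hπ (ε := (1/2)^k) (by positivity) (pow_hN k)
  set ε : ℝ := (1/2)^k with hε
  have hε0 : 0 < ε := by positivity
  have h1 : ε < 2 * t := by rw [pow_succ] at hk1; linarith
  have h2 : RintCE Γ ε ≤ (1 + 2 / ε) * t ^ 2 := hR.trans (by gcongr)
  have h3 : 2 / ε * t ^ 2 + ε ≤ 3 * t := by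
    rw [div_mul_eq_mul_div, ← le_sub_iff_add_le, div_le_iff₀ hε0]
    nlinarith [mul_nonneg (sub_nonneg.2 hk2) (sub_nonneg.2 h1.le)]
  nlinarith

lemma S_le (Γ : Measure (I01 × Bool)) {π : Measure (I01 × I01 × Bool)}
    (hπ : π ∈ extSet Γ) : (SintCE Γ / 4) ^ 2 ≤ ∫ p, |(p.1 : ℝ) - (p.2.1 : ℝ)| ∂π := by
  have hprob := hπ.1
  set d := ∫ p, |(p.1 : ℝ) - (p.2.1 : ℝ)| ∂π with hd
  have hd0 : 0 ≤ d := integral_nonneg fun _ => abs_nonneg _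
  have hd1 : d ≤ 1 := by
    have := norm_integral_le_of_norm_le_const (μ := π) (C := 1) (f := fun p =>
      |(p.1 : ℝ) - (p.2.1 : ℝ)|) (Filter.Eventually.of_forall fun p => by
        rw [Real.norm_eq_abs, abs_abs]; exact abs_I_sub _ _)
    rw [Real.norm_eq_abs] at this
    simpa using (le_abs_self _).trans this
  by_contra! hlt
  have hS := S_nonneg Γ
  have h0 : Real.sqrt d < SintCE Γ / 4 := by
    rw [Real.sqrt_lt' ]
    · exact hlt
    · by_contra! h
      have : SintCE Γ = 0 := by linarith
      rw [this] at hlt; norm_num at hlt; linarith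
  rcases eq_or_lt_of_le hd1 with h1 | h1
  · have := S_le_t Γ hπ one_pos le_rfl (by rw [← hd, h1]; norm_num)
    rw [h1, Real.sqrt_one] at h0; linarith
  · have hs1 : Real.sqrt d < 1 := by rw [Real.sqrt_lt' one_pos]; simpa using h1
    obtain ⟨t, ht1, ht2⟩ := exists_between (lt_min h0 hs1)
    have hs0 := Real.sqrt_nonneg d
    have := S_le_t Γ hπ (t := t) (by linarith) (ht2.le.trans (min_le_right _ _)) (by
      rw [← hd]; nlinarith [Real.sq_sqrt hd0])
    have := ht2.trans_le (min_le_left _ _)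
    linarith

lemma ext_nonempty (Γ : Measure (I01 × Bool)) [IsProbabilityMeasure Γ] : (extSet Γ).Nonempty := by
  have hi : Integrable (fun p : I01 × Bool => lbl p.2) Γ :=
    int_bdd Γ meas_y 1 fun p => by rw [abs_of_nonneg (lbl_nonneg _)]; exact lbl_le_one _
  have h1 : ∫ p, lbl p.2 ∂Γ ≤ 1 := by
    have := integral_mono hi (integrable_const (1:ℝ)) fun p => lbl_le_one p.2
    simpa using this
  let c : I01 := ⟨∫ p, lbl p.2 ∂Γ, integral_nonneg fun p => lbl_nonneg p.2, h1⟩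
  have hm : Measurable (fun p : I01 × Bool => (c, p)) := measurable_const.prodMk measurable_id
  refine ⟨Γ.map (fun p => (c, p)), Measure.isProbabilityMeasure_map hm.aemeasurable, ?_, ?_⟩
  · rw [Measure.map_map (by fun_prop) hm]
    exact Measure.map_id
  · rw [Measure.map_map (by fun_prop) hm]
    rintro w hw -
    unfold calErr
    have hm2 : Measurable ((fun p : I01 × I01 × Bool => (p.1, p.2.2)) ∘ fun p : I01 × Bool => (c, p)) := by
      fun_prop
    have hm3 : Measurable (fun p : I01 × Bool => (lbl p.2 - (p.1 : ℝ)) * w p.1) :=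
      (meas_y.sub meas_v).mul (hw.comp measurable_fst)
    rw [integral_map hm2.aemeasurable hm3.aestronglyMeasurable]
    simp only [Function.comp]
    rw [integral_mul_const, integral_sub hi (integrable_const _)]
    simp [c]

/-- `udCE(Γ) ≤ intCE(Γ) ≤ SintCE(Γ) ≤ 6·√(ldCE(Γ))`. -/
theorem SintCE_bounds (Γ : Measure (I01 × Bool)) [IsProbabilityMeasure Γ] :
    udCE Γ ≤ intCE Γ ∧ intCE Γ ≤ SintCE Γ ∧ SintCE Γ ≤ 6 * Real.sqrt (ldCE Γ) := by
  refine ⟨ud_le_int Γ, int_le_S Γ, ?_⟩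
  have h : (SintCE Γ / 4) ^ 2 ≤ ldCE Γ := by
    obtain ⟨π, hπ⟩ := ext_nonempty Γ
    refine le_csInf ⟨_, π, hπ, rfl⟩ ?_
    rintro x ⟨π, hπ, rfl⟩
    exact S_le Γ hπ
  have h2 := Real.le_sqrt_of_sq_le h
  have h3 := Real.sqrt_nonneg (ldCE Γ)
  linarith
end
end

section
/- For every probability distribution Γ over [0,1]×{0,1} and every ε > 0, the random interval calibration error is monotone under doubling of the interval width: RintCE(Γ,2ε) ≤ RintCE(Γ,ε). -/
open MeasureTheory Set

noncomputable section

/-- Signed calibration mass of `[x, x+w)`. -/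
def PhiAux (Γ : Measure (I01 × Bool)) (w x : ℝ) : ℝ :=
  ∫ p, Set.indicator (Set.Ico x (x + w)) (fun _ => (lbl p.2 - (p.1 : ℝ))) (p.1 : ℝ) ∂Γ

lemma lbl_sub_bound (p : I01 × Bool) : |lbl p.2 - (p.1 : ℝ)| ≤ 1 := by
  have h0 := p.1.2.1
  have h1 := p.1.2.2
  unfold lbl
  rw [abs_le]
  split_ifs <;> constructor <;> linarith

lemma measurable_lbl_sub : Measurable (fun p : I01 × Bool => lbl p.2 - (p.1 : ℝ)) := by
  have : Measurable lbl := measurable_of_countable _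
  exact (this.comp measurable_snd).sub (measurable_subtype_coe.comp measurable_fst)

lemma measurable_ind (w : ℝ) : Measurable (fun q : ℝ × (I01 × Bool) =>
    Set.indicator (Set.Ico q.1 (q.1 + w)) (fun _ => (lbl q.2.2 - (q.2.1 : ℝ))) (q.2.1 : ℝ)) := by
  have hc : Measurable (fun q : ℝ × (I01 × Bool) => (q.2.1 : ℝ)) :=
    measurable_subtype_coe.comp (measurable_fst.comp measurable_snd)
  have hS : MeasurableSet {q : ℝ × (I01 × Bool) | q.1 ≤ (q.2.1 : ℝ) ∧ (q.2.1 : ℝ) < q.1 + w} :=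
    (measurableSet_le measurable_fst hc).inter
      (measurableSet_lt hc (measurable_fst.add_const w))
  have := (measurable_lbl_sub.comp (measurable_snd (α := ℝ))).indicator hS
  convert this using 2 with q
  simp [Set.indicator]

lemma integrable_ind (Γ : Measure (I01 × Bool)) [IsProbabilityMeasure Γ] (w x : ℝ) :
    Integrable (fun p : I01 × Bool => Set.indicator (Set.Ico x (x + w))
      (fun _ => (lbl p.2 - (p.1 : ℝ))) (p.1 : ℝ)) Γ := by
  refine Integrable.of_bound
    ((measurable_ind w).comp (measurable_prodMk_left (x := x))).aestronglyMeasurable 1 ?_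
  refine Filter.Eventually.of_forall fun p => ?_
  exact (norm_indicator_le_norm_self _ _).trans (lbl_sub_bound p)

lemma PhiAux_bound (Γ : Measure (I01 × Bool)) [IsProbabilityMeasure Γ] (w x : ℝ) :
    ‖PhiAux Γ w x‖ ≤ 1 := by
  have := norm_integral_le_of_norm_le_const (μ := Γ) (C := 1)
    (f := fun p : I01 × Bool => Set.indicator (Set.Ico x (x + w))
      (fun _ => (lbl p.2 - (p.1 : ℝ))) (p.1 : ℝ))
    (Filter.Eventually.of_forall fun p =>
      (norm_indicator_le_norm_self _ _).trans (lbl_sub_bound p))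
  simpa [PhiAux] using this

lemma PhiAux_integrable (Γ : Measure (I01 × Bool)) [IsProbabilityMeasure Γ] (w : ℝ) :
    Integrable (PhiAux Γ w) := by
  have hm : StronglyMeasurable (PhiAux Γ w) :=
    (measurable_ind w).stronglyMeasurable.integral_prod_right'
  have hs : ∀ x, x ∉ Set.Icc (-w) 1 → PhiAux Γ w x = 0 := by
    intro x hx
    unfold PhiAux
    rw [← integral_zero (I01 × Bool) ℝ (μ := Γ)]
    congr 1
    ext p
    refine Set.indicator_of_notMem ?_ _
    intro hp
    exact hx ⟨by linarith [hp.2, p.1.2.1], hp.1.trans p.1.2.2⟩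
  have : IntegrableOn (PhiAux Γ w) (Set.Icc (-w) 1) :=
    Measure.integrableOn_of_bounded (M := 1) (by simp) hm.aestronglyMeasurable
      (Filter.Eventually.of_forall fun x => PhiAux_bound Γ w x)
  exact (integrableOn_iff_integrable_of_support_subset
    (fun x hx => by by_contra h; exact hx (hs x h))).1 this

lemma PhiAux_double (Γ : Measure (I01 × Bool)) [IsProbabilityMeasure Γ] (w x : ℝ) (hw : 0 < w) :
    PhiAux Γ (2 * w) x = PhiAux Γ w x + PhiAux Γ w (x + w) := by
  unfold PhiAux
  rw [← integral_add (integrable_ind Γ w x) (integrable_ind Γ w (x + w))]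
  congr 1
  ext p
  rw [show x + 2 * w = x + w + w by ring,
    ← Set.Ico_union_Ico_eq_Ico (b := x + w) (by linarith) (by linarith),
    Set.indicator_union_of_disjoint]
  exact Set.disjoint_left.2 fun a ha hb => absurd ha.2 (not_lt.2 hb.1)

lemma unfold_aux (g : ℝ → ℝ) (hg : Integrable g) (ε : ℝ) (hε : 0 < ε) :
    ∫ r in Set.Ico (0 : ℝ) ε, ∑' j : ℤ, |g (r + (j : ℝ) * ε)| = ∫ x, |g x| := by
  have hU := iUnion_Ico_zsmul hε
  have hI := hasSum_integral_iUnion (μ := volume) (f := fun x => |g x|)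
    (s := fun n : ℤ => Set.Ico (n • ε) ((n + 1) • ε)) (fun _ => measurableSet_Ico)
    (pairwise_disjoint_Ico_zsmul ε) hg.abs.integrableOn
  rw [hU, setIntegral_univ] at hI
  have ht : ∀ n : ℤ, ∫ x in Set.Ico (n • ε) ((n + 1) • ε), |g x|
      = ∫ r in Set.Ico (0 : ℝ) ε, |g (r + (n : ℝ) * ε)| := by
    intro n
    have h2 : n • ε ≤ (n + 1) • ε := by
      simp only [zsmul_eq_mul]; push_cast; nlinarith
    rw [integral_Ico_eq_integral_Ioc, integral_Ico_eq_integral_Ioc,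
      ← intervalIntegral.integral_of_le h2, ← intervalIntegral.integral_of_le hε.le,
      intervalIntegral.integral_comp_add_right (fun x => |g x|)]
    congr 1 <;> simp only [zsmul_eq_mul] <;> push_cast <;> ring
  simp only [ht] at hI
  rw [← hI.tsum_eq, integral_tsum_of_summable_integral_norm]
  · intro n
    exact (hg.comp_add_right _).abs.integrableOn
  · simpa using hI.summable

lemma RintCE_eq_s14 (Γ : Measure (I01 × Bool)) [IsProbabilityMeasure Γ] (ε : ℝ) (hε : 0 < ε) :
    RintCE Γ ε = (1 / ε) * ∫ x, |PhiAux Γ ε x| := by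
  rw [← unfold_aux _ (PhiAux_integrable Γ ε) ε hε]
  unfold RintCE PhiAux
  simp only [add_mul, one_mul, add_assoc]

/-- `RintCE(Γ, 2ε) ≤ RintCE(Γ, ε)`. -/
theorem RintCE_double_le (Γ : Measure (I01 × Bool)) [IsProbabilityMeasure Γ]
    (ε : ℝ) (hε : 0 < ε) :
    RintCE Γ (2 * ε) ≤ RintCE Γ ε := by
  rw [RintCE_eq_s14 Γ ε hε, RintCE_eq_s14 Γ (2 * ε) (by linarith)]
  have hi := (PhiAux_integrable Γ ε).abs
  have hi2 := hi.comp_add_right ε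
  have h : ∫ x, |PhiAux Γ (2 * ε) x| ≤ 2 * ∫ x, |PhiAux Γ ε x| := by
    calc ∫ x, |PhiAux Γ (2 * ε) x|
        ≤ ∫ x, (|PhiAux Γ ε x| + |PhiAux Γ ε (x + ε)|) := by
          refine integral_mono (PhiAux_integrable Γ (2 * ε)).abs (hi.add hi2) fun x => ?_
          simp only [PhiAux_double Γ ε x hε]
          exact abs_add_le _ _
      _ = 2 * ∫ x, |PhiAux Γ ε x| := by
          rw [integral_add hi hi2,
            integral_add_right_eq_self (fun x => |PhiAux Γ ε x|) ε]
          ring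
  calc 1 / (2 * ε) * ∫ x, |PhiAux Γ (2 * ε) x|
      ≤ 1 / (2 * ε) * (2 * ∫ x, |PhiAux Γ ε x|) := by gcongr
    _ = 1 / ε * ∫ x, |PhiAux Γ ε x| := by field_simp
end
end

section
/- For every α ∈ (0,1/4), there exist a finite set 𝒳 (a four-element set suffices), a probability distribution D over 𝒳×{0,1}, and a predictor f:𝒳→[0,1] such that udCE_D(f) ≤ 5α² and intCE_D(f) ≥ α. -/
open MeasureTheory Set

noncomputable section

def qgM {ι X : Type} [Fintype ι] [MeasurableSpace X] (w : ι → ℝ) (g : ι → X) : Measure X :=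
  Measure.sum fun i => ENNReal.ofReal (w i) • Measure.dirac (g i)

theorem qgM_map {ι X Y : Type} [Fintype ι] [MeasurableSpace X] [MeasurableSpace Y]
    (w : ι → ℝ) (g : ι → X) (k : X → Y) (hk : Measurable k) :
    (qgM w g).map k = qgM w (k ∘ g) := by
  unfold qgM
  rw [Measure.map_sum hk.aemeasurable]
  congr 1
  funext i
  rw [Measure.map_smul, Measure.map_dirac' hk]
  rfl

theorem qgM_int {ι X : Type} [Fintype ι] [MeasurableSpace X] [MeasurableSingletonClass X]
    (w : ι → ℝ) (hw : ∀ i, 0 ≤ w i) (g : ι → X) (h : X → ℝ) :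
    ∫ x, h x ∂(qgM w g) = ∑ i, w i * h (g i) := by
  unfold qgM
  rw [Measure.sum_fintype, integral_finsetSum_measure]
  · refine Finset.sum_congr rfl fun i _ => ?_
    rw [integral_smul_measure, integral_dirac, ENNReal.toReal_ofReal (hw i), smul_eq_mul]
  · intro i _
    exact (integrable_dirac (by simp)).smul_measure ENNReal.ofReal_ne_top

theorem qgM_prob {ι X : Type} [Fintype ι] [MeasurableSpace X]
    (w : ι → ℝ) (hw : ∀ i, 0 ≤ w i) (g : ι → X) (h1 : ∑ i, w i = 1) :
    IsProbabilityMeasure (qgM w g) := by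
  constructor
  unfold qgM
  rw [Measure.sum_fintype]
  simp only [Measure.coe_finsetSum, Finset.sum_apply, Measure.smul_apply, measure_univ,
    smul_eq_mul, mul_one]
  rw [← ENNReal.ofReal_sum_of_nonneg (fun i _ => hw i), h1, ENNReal.ofReal_one]

def qgW (m β : ℝ) (i : Fin 4 × Bool) : ℝ :=
  if i.2 then ![β, 0, m, 1/2 - m - β] i.1 else ![1/2 - m - β, m, 0, β] i.1

theorem qg_sum (m β : ℝ) (F : Fin 4 × Bool → ℝ) :
    ∑ i, qgW m β i * F i = β * F (0, true) + (1/2 - m - β) * F (0, false) + m * F (1, false)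
      + m * F (2, true) + (1/2 - m - β) * F (3, true) + β * F (3, false) := by
  rw [Fintype.sum_prod_type]
  simp [Fin.sum_univ_four, qgW]
  ring

set_option maxHeartbeats 2000000 in
/-- For every `α ∈ (0, 1/4)` there exist a four-element domain, a
distribution `D`, and a predictor `f` with `udCE_D(f) ≤ 5α²` and `intCE_D(f) ≥ α`:
a quadratic gap between interval calibration and the upper distance to calibration. -/
theorem intCE_udCE_quadratic_gap (α : ℝ) (hα : 0 < α) (hα' : α < 1 / 4) :
    ∃ (D : Measure (Fin 4 × Bool)) (f : Fin 4 → I01),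
      IsProbabilityMeasure D ∧
      udCE (predDist D f) ≤ 5 * α ^ 2 ∧ α ≤ intCE (predDist D f) := by
  obtain ⟨m, hm⟩ : ∃ m : ℝ, m = α - 3 / 2 * α ^ 2 := ⟨_, rfl⟩
  obtain ⟨β, hβ⟩ : ∃ β : ℝ, β = (1/2 - m) * (1/2 - α/2) - α/2 := ⟨_, rfl⟩
  have hm0 : 0 ≤ m := by nlinarith
  have hmα : m ≤ α := by nlinarith
  have hm1 : 0 ≤ 1/2 - m := by linarith
  have hβ0 : 0 ≤ β := by
    have : 4 * β = 1 - 5 * α + 5 * α^2 - 3 * α^3 := by rw [hβ, hm]; ring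
    have h2 : 0 ≤ α ^ 2 * (1/4 - α) := by apply mul_nonneg <;> [positivity; linarith]
    nlinarith
  have hβ1 : 0 ≤ 1/2 - m - β := by rw [hβ]; nlinarith
  obtain ⟨c, hc⟩ : ∃ c : ℝ, c = 2 * (β + m) := ⟨_, rfl⟩
  have hcp : 1/2 - α/2 - c = α^2/2 + 3/2 * α^3 := by rw [hc, hβ, hm]; ring
  have hc0 : 0 ≤ c := by linarith
  have h3 : 0 < α ^ 3 := by positivity
  have hc1 : c ≤ 1/2 := by nlinarith
  have hw : ∀ i, 0 ≤ qgW m β i := by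
    rintro ⟨x, y⟩
    fin_cases x <;> cases y <;> simp [qgW] <;> linarith
  let p0 : I01 := ⟨1/2 - α/2, by constructor <;> linarith⟩
  let p1 : I01 := ⟨1/2 - α/4, by constructor <;> linarith⟩
  let p2 : I01 := ⟨1/2 + α/4, by constructor <;> linarith⟩
  let p3 : I01 := ⟨1/2 + α/2, by constructor <;> linarith⟩
  let C : I01 := ⟨c, by constructor <;> linarith⟩
  let C' : I01 := ⟨1 - c, by constructor <;> linarith⟩
  let f : Fin 4 → I01 := ![p0, p1, p2, p3]
  have hmf : Measurable (fun p : Fin 4 × Bool => (f p.1, p.2)) := measurable_of_finite _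
  have hΓ : predDist (qgM (qgW m β) id) f = qgM (qgW m β) (fun p => (f p.1, p.2)) := by
    unfold predDist
    rw [qgM_map _ _ _ hmf]; rfl
  refine ⟨qgM (qgW m β) id, f, qgM_prob _ hw _ ?_, ?_, ?_⟩
  · have := qg_sum m β (fun _ => 1)
    simp only [mul_one] at this
    rw [this]; ring
  · rw [hΓ]
    classical
    let κ : I01 → I01 := fun t => if t ∈ ({p0, p2} : Set I01) then C else C'
    have hκ : Measurable κ :=
      Measurable.ite (Set.toFinite ({p0, p2} : Set I01)).measurableSet measurable_const measurable_const
    have k0 : κ p0 = C := by simp [κ]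
    have k2 : κ p2 = C := by simp [κ]
    have k1 : κ p1 = C' := by
      have a1 : p1 ≠ p0 := by
        intro h; have := congrArg Subtype.val h; simp only [p1, p0] at this; linarith
      have a2 : p1 ≠ p2 := by
        intro h; have := congrArg Subtype.val h; simp only [p1, p2] at this; linarith
      simp [κ, a1, a2]
    have k3 : κ p3 = C' := by
      have a1 : p3 ≠ p0 := by
        intro h; have := congrArg Subtype.val h; simp only [p3, p0] at this; linarith
      have a2 : p3 ≠ p2 := by
        intro h; have := congrArg Subtype.val h; simp only [p3, p2] at this; linarith
      simp [κ, a1, a2]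
    have f0 : f 0 = p0 := rfl
    have f1 : f 1 = p1 := rfl
    have f2 : f 2 = p2 := rfl
    have f3 : f 3 = p3 := rfl
    unfold udCE
    refine le_trans (csInf_le ?_ ?_ : _ ≤ ∫ p, |(p.1 : ℝ) - (κ p.1 : ℝ)|
      ∂(qgM (qgW m β) (fun p => (f p.1, p.2)))) ?_
    · refine ⟨0, ?_⟩
      rintro x ⟨κ', -, -, rfl⟩
      exact integral_nonneg fun _ => abs_nonneg _
    · refine ⟨κ, hκ, ?_, rfl⟩
      intro w _ _
      unfold calErr
      rw [qgM_map _ _ _ (by fun_prop), qgM_int _ hw, qg_sum]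
      simp only [Function.comp, f0, f1, f2, f3, k0, k1, k2, k3]
      have v1 : (C : ℝ) = c := rfl
      have v2 : (C' : ℝ) = 1 - c := rfl
      simp only [lbl, v1, v2, if_true, Bool.false_eq_true, if_false]
      generalize w C = A
      generalize w C' = B
      linear_combination (B - A) / 2 * hc
    · rw [qgM_int _ hw, qg_sum]
      simp only [f0, f1, f2, f3, k0, k1, k2, k3]
      simp only [p0, p1, p2, p3, C, C']
      have e0 : |1/2 - α/2 - c| = 1/2 - α/2 - c := abs_of_nonneg (by rw [hcp]; positivity)
      have e2 : |1/2 + α/4 - c| = 1/2 + α/4 - c := abs_of_nonneg (by linarith)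
      have e3 : |1/2 + α/2 - (1 - c)| = 1/2 - α/2 - c := by
        rw [abs_sub_comm]; rw [abs_of_nonneg] <;> [ring; (nlinarith)]
      have e1 : |1/2 - α/4 - (1 - c)| = 1/2 + α/4 - c := by
        rw [abs_sub_comm]; rw [abs_of_nonneg] <;> [ring; (nlinarith)]
      rw [e0, e1, e2, e3]
      have h4 : 1/2 + α/4 - c = 3/4*α + (α^2/2 + 3/2 * α^3) := by linarith
      rw [h4, hcp]
      have h5 : α^3 ≤ α^2/4 := by nlinarith [sq_nonneg α]
      have h6 : m * α ≤ α^2 := by nlinarith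
      nlinarith
  · rw [hΓ]
    refine le_csInf ⟨_, ⟨1, fun _ => Set.Icc 0 1, fun _ => Set.ordConnected_Icc,
      fun i j h => absurd (Subsingleton.elim i j) h, Set.iUnion_const _⟩, rfl⟩ ?_
    rintro x ⟨P, rfl⟩
    have hsub : ∀ j, P.piece j ⊆ Set.Icc (0:ℝ) 1 := fun j => by
      rw [← P.cover]; exact Set.subset_iUnion _ j
    have hex : ∀ t : I01, ∃ j, (t : ℝ) ∈ P.piece j := fun t => by
      have h : (t : ℝ) ∈ ⋃ j, P.piece j := by rw [P.cover]; exact t.2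
      exact Set.mem_iUnion.1 h
    have hdis : ∀ i j (t : ℝ), t ∈ P.piece i → t ∈ P.piece j → i = j := fun i j t hi hj => by
      by_contra h
      exact Set.disjoint_left.1 (P.disj i j h) hi hj
    have f0 : (f 0 : ℝ) = 1/2 - α/2 := rfl
    have f1 : (f 1 : ℝ) = 1/2 - α/4 := rfl
    have f2 : (f 2 : ℝ) = 1/2 + α/4 := rfl
    have f3 : (f 3 : ℝ) = 1/2 + α/2 := rfl
    obtain ⟨j0, h0⟩ := hex p0
    obtain ⟨j3, h3'⟩ := hex p3
    change 1/2 - α/2 ∈ P.piece j0 at h0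
    change 1/2 + α/2 ∈ P.piece j3 at h3'
    have hb0 : 0 ≤ binnedECE (qgM (qgW m β) (fun p => (f p.1, p.2))) P :=
      Finset.sum_nonneg fun _ _ => abs_nonneg _
    have hnn : ∀ j, 0 ≤ (∫ p, Set.indicator (P.piece j) (fun _ => (1 : ℝ)) (p.1 : ℝ)
        ∂(qgM (qgW m β) (fun p => (f p.1, p.2)))) * Metric.diam (P.piece j) := fun j =>
      mul_nonneg (integral_nonneg fun p => Set.indicator_nonneg (fun _ _ => zero_le_one) _)
        Metric.diam_nonneg
    have hw0 : 0 ≤ avgWidth (qgM (qgW m β) (fun p => (f p.1, p.2))) P :=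
      Finset.sum_nonneg fun j _ => hnn j
    by_cases hj : j0 = j3
    · subst hj
      have h1 : 1/2 - α/4 ∈ P.piece j0 :=
        (P.ordConn j0).out h0 h3' ⟨by linarith, by linarith⟩
      have h2 : 1/2 + α/4 ∈ P.piece j0 :=
        (P.ordConn j0).out h0 h3' ⟨by linarith, by linarith⟩
      have hd : α ≤ Metric.diam (P.piece j0) := by
        have := Metric.dist_le_diam_of_mem
          ((Metric.isBounded_Icc (0:ℝ) 1).subset (hsub j0)) h3' h0
        rw [Real.dist_eq, abs_of_nonneg (by linarith)] at this
        linarith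
      have key := Finset.single_le_sum (f := fun j => (∫ p, Set.indicator (P.piece j)
        (fun _ => (1 : ℝ)) (p.1 : ℝ) ∂(qgM (qgW m β) (fun p => (f p.1, p.2)))) *
          Metric.diam (P.piece j)) (fun j _ => hnn j) (Finset.mem_univ j0)
      have hone : (∫ p, Set.indicator (P.piece j0)
        (fun _ => (1 : ℝ)) (p.1 : ℝ) ∂(qgM (qgW m β) (fun p => (f p.1, p.2)))) = 1 := by
        rw [qgM_int _ hw, qg_sum]
        simp only [f0, f1, f2, f3]
        simp only [Set.indicator_of_mem, h0, h1, h2, h3']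
        ring
      simp only [hone, one_mul] at key
      have : Metric.diam (P.piece j0) ≤ avgWidth (qgM (qgW m β) (fun p => (f p.1, p.2))) P := key
      linarith
    · have key : |∫ p, Set.indicator (P.piece j0) (fun _ => ((p.1 : ℝ) - lbl p.2)) (p.1 : ℝ)
            ∂(qgM (qgW m β) (fun p => (f p.1, p.2)))| +
          |∫ p, Set.indicator (P.piece j3) (fun _ => ((p.1 : ℝ) - lbl p.2)) (p.1 : ℝ)
            ∂(qgM (qgW m β) (fun p => (f p.1, p.2)))| ≤
          binnedECE (qgM (qgW m β) (fun p => (f p.1, p.2))) P := by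
        unfold binnedECE
        rw [← Finset.sum_pair hj (f := fun j => |∫ p, Set.indicator (P.piece j)
          (fun _ => ((p.1 : ℝ) - lbl p.2)) (p.1 : ℝ)
            ∂(qgM (qgW m β) (fun p => (f p.1, p.2)))|)]
        exact Finset.sum_le_sum_of_subset_of_nonneg (Finset.subset_univ _)
          fun _ _ _ => abs_nonneg _
      have hn3 : 1/2 + α/2 ∉ P.piece j0 := fun h => hj (hdis _ _ _ h h3')
      have hn0 : 1/2 - α/2 ∉ P.piece j3 := fun h => hj (hdis _ _ _ h0 h)
      have hx0 : 1/2 + α/4 ∈ P.piece j0 → 1/2 - α/4 ∈ P.piece j0 := fun h =>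
        (P.ordConn j0).out h0 h ⟨by linarith, by linarith⟩
      have hx3 : 1/2 - α/4 ∈ P.piece j3 → 1/2 + α/4 ∈ P.piece j3 := fun h =>
        (P.ordConn j3).out h h3' ⟨by linarith, by linarith⟩
      have hmb : 0 ≤ m * (1/2 - α/4) := mul_nonneg hm0 (by linarith)
      have E0 : α/2 ≤ ∫ p, Set.indicator (P.piece j0) (fun _ => ((p.1 : ℝ) - lbl p.2)) (p.1 : ℝ)
            ∂(qgM (qgW m β) (fun p => (f p.1, p.2))) := by
        rw [qgM_int _ hw, qg_sum]
        simp only [f0, f1, f2, f3, lbl, if_true, Bool.false_eq_true, if_false]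
        by_cases h2 : 1/2 + α/4 ∈ P.piece j0
        · have h1 := hx0 h2
          simp only [Set.indicator_of_mem, Set.indicator_of_notMem, h0, h1, h2, hn3,
            not_false_eq_true]
          rw [hβ]; linarith
        · by_cases h1 : 1/2 - α/4 ∈ P.piece j0 <;>
          simp only [Set.indicator_of_mem, Set.indicator_of_notMem, h0, h1, h2, hn3,
            not_false_eq_true] <;> rw [hβ] <;> linarith
      have E3 : (∫ p, Set.indicator (P.piece j3) (fun _ => ((p.1 : ℝ) - lbl p.2)) (p.1 : ℝ)
            ∂(qgM (qgW m β) (fun p => (f p.1, p.2)))) ≤ -(α/2) := by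
        rw [qgM_int _ hw, qg_sum]
        simp only [f0, f1, f2, f3, lbl, if_true, Bool.false_eq_true, if_false]
        by_cases h1 : 1/2 - α/4 ∈ P.piece j3
        · have h2 := hx3 h1
          simp only [Set.indicator_of_mem, Set.indicator_of_notMem, h3', h1, h2, hn0,
            not_false_eq_true]
          rw [hβ]; linarith
        · by_cases h2 : 1/2 + α/4 ∈ P.piece j3 <;>
          simp only [Set.indicator_of_mem, Set.indicator_of_notMem, h3', h1, h2, hn0,
            not_false_eq_true] <;> rw [hβ] <;> linarith
      have a0 := le_abs_self (∫ p, Set.indicator (P.piece j0) (fun _ => ((p.1 : ℝ) - lbl p.2))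
        (p.1 : ℝ) ∂(qgM (qgW m β) (fun p => (f p.1, p.2))))
      have a3 := neg_le_abs (∫ p, Set.indicator (P.piece j3) (fun _ => ((p.1 : ℝ) - lbl p.2))
        (p.1 : ℝ) ∂(qgM (qgW m β) (fun p => (f p.1, p.2))))
      linarith
end
end

section
/- For every 1-Lipschitz function w:[0,1]→[−1,1] and every ε > 0, there exists a continuously differentiable function w̃:ℝ→ℝ with compact support such that ∫_ℝ w̃(t)² dt + ∫_ℝ w̃′(t)² dt ≤ 9 and |w(t) − w̃(t)| ≤ ε for all t ∈ [0,1]. -/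
open MeasureTheory Set

noncomputable section

theorem aux_ext (w : ℝ → ℝ)
    (hw : LipschitzOnWith 1 w (Set.Icc 0 1))
    (hwb : ∀ t ∈ Set.Icc (0 : ℝ) 1, |w t| ≤ 1) :
    ∃ g : ℝ → ℝ, (∀ x y, |g x - g y| ≤ |x - y|) ∧ (∀ t, |g t| ≤ 1) ∧
      (∀ t, t ≤ -1 → g t = 0) ∧ (∀ t, 2 ≤ t → g t = 0) ∧
      ∀ t ∈ Set.Icc (0 : ℝ) 1, g t = w t := by
  obtain ⟨v, hv, he⟩ := hw.extend_real
  have hφ : LipschitzWith 1 (fun t : ℝ => max 0 (min 1 (min (1 + t) (2 - t)))) := by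
    have h1 : LipschitzWith 1 (fun t : ℝ => 1 + t) :=
      LipschitzWith.of_dist_le_mul (fun x y => by simp)
    have h2 : LipschitzWith 1 (fun t : ℝ => 2 - t) :=
      LipschitzWith.of_dist_le_mul (fun x y => by
        simp only [Real.dist_eq, NNReal.coe_one, one_mul]
        rw [abs_sub_comm x y]; exact le_of_eq (by congr 1; ring))
    have h3 := ((h1.min h2).const_min 1).const_max 0
    simpa using h3
  have hnφ : LipschitzWith 1 (fun t : ℝ => -max 0 (min 1 (min (1 + t) (2 - t)))) := hφ.neg
  have hg := hnφ.max (hφ.min hv)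
  refine ⟨fun t => max (-max 0 (min 1 (min (1 + t) (2 - t))))
      (min (max 0 (min 1 (min (1 + t) (2 - t)))) (v t)),
    fun x y => ?_, fun t => ?_, fun t ht => ?_, fun t ht => ?_, fun t ht => ?_⟩
  · have := hg.dist_le_mul x y
    simpa [Real.dist_eq] using this
  · have h0 : 0 ≤ max 0 (min 1 (min (1 + t) (2 - t))) := le_max_left _ _
    have h1 : max 0 (min 1 (min (1 + t) (2 - t))) ≤ 1 := max_le zero_le_one (min_le_left _ _)
    exact abs_le.2 ⟨le_max_of_le_left (by linarith),
      max_le (by linarith) ((min_le_left _ _).trans h1)⟩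
  · have h3 : max 0 (min 1 (min (1 + t) (2 - t))) = 0 :=
      max_eq_left ((min_le_right _ _).trans ((min_le_left _ _).trans (by linarith)))
    simp only [h3, neg_zero]
    exact max_eq_left (min_le_left _ _)
  · have h3 : max 0 (min 1 (min (1 + t) (2 - t))) = 0 :=
      max_eq_left ((min_le_right _ _).trans ((min_le_right _ _).trans (by linarith)))
    simp only [h3, neg_zero]
    exact max_eq_left (min_le_left _ _)
  · have := abs_le.1 (hwb t ht)
    have h2 := he ht
    obtain ⟨h0, h1⟩ := ht
    have h3 : max 0 (min 1 (min (1 + t) (2 - t))) = 1 := by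
      rw [min_eq_left (le_min (by linarith) (by linarith)), max_eq_right zero_le_one]
    simp only [h3]
    rw [← h2, min_eq_right this.2, max_eq_right this.1]

theorem aux_int (f : ℝ → ℝ) (hb : ∀ t, |f t| ≤ 1) (hz : ∀ t, t ∉ Set.Icc (-2 : ℝ) 2 → f t = 0) :
    ∫ t, (f t) ^ 2 ≤ 4 := by
  have h1 : ∫ t, (f t) ^ 2 ≤ ∫ t, (Set.Icc (-2 : ℝ) 2).indicator (fun _ => (1 : ℝ)) t := by
    apply integral_mono_of_nonneg
    · exact Filter.Eventually.of_forall fun t => sq_nonneg _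
    · rw [integrable_indicator_iff measurableSet_Icc]
      simp
    · refine Filter.Eventually.of_forall fun t => ?_
      by_cases ht : t ∈ Set.Icc (-2 : ℝ) 2
      · simpa [Set.indicator_of_mem ht] using hb t
      · simp [Set.indicator_of_notMem ht, hz t ht]
  refine h1.trans ?_
  rw [integral_indicator measurableSet_Icc]
  simp
  norm_num

/-- Every `1`-Lipschitz `w : [0,1] → [−1,1]` can be uniformly approximated
on `[0,1]`, to any accuracy `ε > 0`, by a `C¹` compactly supported `w̃ : ℝ → ℝ` with
`∫ w̃² + ∫ (w̃′)² ≤ 9` (i.e. Laplace-RKHS norm at most 3). -/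
theorem lipschitz_approx_laplace_rkhs (w : ℝ → ℝ)
    (hw : LipschitzOnWith 1 w (Set.Icc 0 1))
    (hwb : ∀ t ∈ Set.Icc (0 : ℝ) 1, |w t| ≤ 1) (ε : ℝ) (hε : 0 < ε) :
    ∃ w' : ℝ → ℝ, ContDiff ℝ 1 w' ∧ HasCompactSupport w' ∧
      (∫ t, (w' t) ^ 2) + (∫ t, (deriv w' t) ^ 2) ≤ 9 ∧
      ∀ t ∈ Set.Icc (0 : ℝ) 1, |w t - w' t| ≤ ε := by
  obtain ⟨g, hL, hB, hz1, hz2, hgw⟩ := aux_ext w hw hwb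
  have hc : Continuous g := (LipschitzWith.of_dist_le_mul (K := 1)
    (fun x y => by simpa [Real.dist_eq] using hL x y)).continuous
  obtain ⟨δ, hδ, hδ1, hδε⟩ : ∃ δ : ℝ, 0 < δ ∧ δ ≤ 1 ∧ δ ≤ ε :=
    ⟨min 1 ε, by positivity, min_le_left _ _, min_le_right _ _⟩
  set G : ℝ → ℝ := fun t => ∫ x in (0 : ℝ)..t, g x with hGdef
  have hG : ∀ t, HasDerivAt G (g t) t := fun t => hc.integral_hasStrictDerivAt 0 t |>.hasDerivAt
  set W : ℝ → ℝ := fun t => (G (t + δ) - G t) / δ with hWdef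
  have hW : ∀ t, HasDerivAt W ((g (t + δ) - g t) / δ) t := fun t =>
    (((hG (t + δ)).comp_add_const t δ).sub (hG t)).div_const δ
  have hd : deriv W = fun t => (g (t + δ) - g t) / δ := funext fun t => (hW t).deriv
  have hmv : ∀ t, ∃ c, t < c ∧ c < t + δ ∧ W t = g c := by
    intro t
    obtain ⟨c, hcm, h⟩ := exists_hasDerivAt_eq_slope G g (by linarith : t < t + δ)
      (fun x _ => (hG x).continuousAt.continuousWithinAt) (fun x _ => hG x)
    refine ⟨c, hcm.1, hcm.2, ?_⟩
    rw [h, hWdef]; simp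
  have hWz : ∀ t, t ∉ Set.Icc (-2 : ℝ) 2 → W t = 0 := by
    intro t ht
    obtain ⟨c, h1, h2, h3⟩ := hmv t
    rw [h3]
    by_cases h : t < -2
    · exact hz1 c (by linarith)
    · refine hz2 c ?_
      by_contra hh
      exact ht ⟨by linarith, by linarith⟩
  have hdz : ∀ t, t ∉ Set.Icc (-2 : ℝ) 2 → deriv W t = 0 := by
    intro t ht
    rw [hd]
    by_cases h : t < -2
    · simp [hz1 t (by linarith), hz1 (t + δ) (by linarith)]
    · have : 2 < t := by
        by_contra hh
        exact ht ⟨by linarith, by linarith⟩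
      simp [hz2 t (by linarith), hz2 (t + δ) (by linarith)]
  refine ⟨W, ?_, ?_, ?_, ?_⟩
  · rw [contDiff_one_iff_deriv]
    refine ⟨fun t => (hW t).differentiableAt, ?_⟩
    rw [hd]; fun_prop
  · exact HasCompactSupport.intro isCompact_Icc hWz
  · have h1 := aux_int W (fun t => by
      obtain ⟨c, _, _, h3⟩ := hmv t
      rw [h3]; exact hB c) hWz
    have h2 := aux_int (deriv W) (fun t => by
      rw [hd]
      simp only [abs_div, abs_of_pos hδ]
      rw [div_le_one hδ]
      have := hL (t + δ) t
      simpa [abs_of_pos hδ] using this) hdz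
    linarith
  · intro t ht
    obtain ⟨c, h1, h2, h3⟩ := hmv t
    rw [h3, ← hgw t ht]
    refine (hL t c).trans ?_
    rw [abs_le]; constructor <;> linarith
end
end
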